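/- arXiv:1010.5938 — 7 statements merged into one kernel-verified Lean document; each statement's English description precedes it below -/
import Mathlib

section
/- Suppose M ≥ 2d, the A_Φ-eigenvalues e^{±iθ_iT_s} (i = 1,…,d) are pairwise distinct and each has nonzero imaginary part, and v_i^H h ≠ 0 for all i = 1,…,d. Then there exist real constants C > 0 and 0 ≤ δ < 1 such that for all x, y ∈ 𝓜 with x ≠ y, C(1−δ)·‖x−y‖₂² ≤ ‖F(x)−F(y)‖₂² ≤ C(1+δ)·‖x−y‖₂². (Linear Takens' Embedding Theorem.) -/
open Complex Matrix Finset

lemma takens_aux {m p n : ℕ} (A : Matrix (Fin m) (Fin n) ℂ) (B : Matrix (Fin p) (Fin n) ℂ)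
    (hA : ∀ b, A *ᵥ b = 0 → b = 0) :
    ∃ K : ℝ, 0 < K ∧ ∀ b : Fin n → ℂ,
      ∑ k, ‖(B *ᵥ b) k‖ ^ 2 ≤ K * ∑ i, ‖(A *ᵥ b) i‖ ^ 2 := by
  have hker : LinearMap.ker (Matrix.toEuclideanLin A) = ⊥ := by
    rw [LinearMap.ker_eq_bot']
    intro b hb
    have h1 : A *ᵥ (WithLp.ofLp b) = 0 := by
      have := congrArg WithLp.ofLp hb
      simpa using this
    have h2 := hA _ h1
    ext i
    simpa using congrFun h2 i
  obtain ⟨K, hK, hanti⟩ := LinearMap.exists_antilipschitzWith _ hker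
  set L := LinearMap.toContinuousLinearMap (Matrix.toEuclideanLin B) with hL
  refine ⟨((‖L‖ + 1) * K) ^ 2, by positivity, fun b => ?_⟩
  have e1 : ∑ k, ‖(B *ᵥ b) k‖ ^ 2 = ‖Matrix.toEuclideanLin B (WithLp.toLp 2 b)‖ ^ 2 := by
    rw [EuclideanSpace.norm_sq_eq]; simp
  have e2 : ∑ k, ‖(A *ᵥ b) k‖ ^ 2 = ‖Matrix.toEuclideanLin A (WithLp.toLp 2 b)‖ ^ 2 := by
    rw [EuclideanSpace.norm_sq_eq]; simp
  rw [e1, e2, ← mul_pow]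
  have h1 : ‖Matrix.toEuclideanLin B (WithLp.toLp 2 b)‖ ≤ ‖L‖ * ‖WithLp.toLp 2 b‖ :=
    L.le_opNorm _
  have h2 : ‖WithLp.toLp 2 b‖ ≤ K * ‖Matrix.toEuclideanLin A (WithLp.toLp 2 b)‖ := by
    have := hanti.le_mul_dist (WithLp.toLp 2 b) 0
    simpa only [map_zero, dist_zero_right] using this
  gcongr
  calc _ ≤ ‖L‖ * ‖WithLp.toLp 2 b‖ := h1
    _ ≤ (‖L‖ + 1) * ‖WithLp.toLp 2 b‖ := by gcongr; linarith
    _ ≤ (‖L‖ + 1) * (K * ‖Matrix.toEuclideanLin A (WithLp.toLp 2 b)‖) := by gcongr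
    _ = _ := by ring

/-- Linear Takens' Embedding Theorem: if `M ≥ 2d`, the `A_Φ`-eigenvalues are
pairwise distinct with nonzero imaginary parts, and `v_i^H h ≠ 0` for all `i`,
then there exist `C > 0` and `0 ≤ δ < 1` such that for all distinct `x, y` on
the attractor `𝓜`, `C(1−δ)‖x−y‖₂² ≤ ‖F(x)−F(y)‖₂² ≤ C(1+δ)‖x−y‖₂²`. -/
theorem stmt0
    (N d M : ℕ) (hN : 0 < N) (hd : 0 < d) (hMpos : 0 < M) (hdN : 2 * d ≤ N)
    (θ : Fin d → ℝ) (hθpos : ∀ i, 0 < θ i) (hθinj : Function.Injective θ)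
    (Ts : ℝ) (hTs : 0 < Ts)
    (v : Fin d → Fin N → ℂ) (hvnorm : ∀ p, ∑ i, ‖v p i‖ ^ 2 = 1)
    (V : Matrix (Fin N) (Fin (2 * d)) ℂ)
    (hV : ∀ (i : Fin N) (j : Fin (2 * d)),
      V i j = if j.val % 2 = 0
        then v ⟨j.val / 2, by have := j.isLt; omega⟩ i
        else (starRingEnd ℂ) (v ⟨j.val / 2, by have := j.isLt; omega⟩ i))
    (hVrank : V.rank = 2 * d)
    (h : Fin N → ℝ) (hh : h ≠ 0)
    (μ : Fin (2 * d) → ℂ)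
    (hμ : ∀ j : Fin (2 * d),
      μ j = if j.val % 2 = 0
        then Complex.exp (-((θ ⟨j.val / 2, by have := j.isLt; omega⟩ * Ts : ℝ) : ℂ) * Complex.I)
        else Complex.exp (((θ ⟨j.val / 2, by have := j.isLt; omega⟩ * Ts : ℝ) : ℂ) * Complex.I))
    (G : Matrix (Fin M) (Fin (2 * d)) ℂ)
    (hG : ∀ (k : Fin M) (j : Fin (2 * d)), G k j = (∑ i, (h i : ℂ) * V i j) * μ j ^ (k : ℕ))
    (vh : Fin d → ℂ) (hvhdef : ∀ p, vh p = ∑ i, (starRingEnd ℂ) (v p i) * (h i : ℂ))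
    (α₀ : Fin (2 * d) → ℂ)
    (lam : Fin (2 * d) → ℂ)
    (hlam : ∀ j : Fin (2 * d),
      lam j = if j.val % 2 = 0
        then ((θ ⟨j.val / 2, by have := j.isLt; omega⟩ : ℝ) : ℂ) * Complex.I
        else -(((θ ⟨j.val / 2, by have := j.isLt; omega⟩ : ℝ) : ℂ)) * Complex.I)
    (X : ℝ → Fin N → ℂ)
    (hX : ∀ (t : ℝ) (i : Fin N), X t i = ∑ j, V i j * (Complex.exp (lam j * (t : ℂ)) * α₀ j))
    (FX : ℝ → Fin M → ℂ)
    (hFX : ∀ (t : ℝ) (k : Fin M), FX t k = ∑ j, G k j * (Complex.exp (lam j * (t : ℂ)) * α₀ j))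
    (hMd : 2 * d ≤ M)
    (hμinj : Function.Injective μ) (hμim : ∀ j, (μ j).im ≠ 0)
    (hvh : ∀ p, vh p ≠ 0) :
    ∃ C δ : ℝ, 0 < C ∧ 0 ≤ δ ∧ δ < 1 ∧
      ∀ tx ty : ℝ, X tx ≠ X ty →
        C * (1 - δ) * (∑ i, ‖X tx i - X ty i‖ ^ 2) ≤ ∑ k, ‖FX tx k - FX ty k‖ ^ 2 ∧
        ∑ k, ‖FX tx k - FX ty k‖ ^ 2 ≤ C * (1 + δ) * (∑ i, ‖X tx i - X ty i‖ ^ 2) := by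
  have hVinj : ∀ b, V *ᵥ b = 0 → b = 0 := by
    have h1 := LinearMap.finrank_range_add_finrank_ker V.mulVecLin
    have h2 : Module.finrank ℂ (LinearMap.range V.mulVecLin) = 2 * d := hVrank
    rw [h2] at h1
    have h3 : Module.finrank ℂ (LinearMap.ker V.mulVecLin) = 0 := by
      simp at h1; simpa using h1
    have h4 := Submodule.finrank_eq_zero.mp h3
    exact fun b hb => LinearMap.ker_eq_bot'.mp h4 b hb
  have hc : ∀ j, (∑ i, (h i : ℂ) * V i j) ≠ 0 := by
    intro j
    have hj : j.val / 2 < d := by have := j.isLt; omega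
    have h1 := hvh ⟨j.val / 2, hj⟩
    rw [hvhdef] at h1
    by_cases hp : j.val % 2 = 0
    · intro h0
      apply h1
      have h2 := congrArg (starRingEnd ℂ) h0
      rw [map_sum, map_zero] at h2
      rw [← h2]
      refine Finset.sum_congr rfl fun i _ => ?_
      rw [hV, if_pos hp, map_mul, Complex.conj_ofReal, mul_comm]
    · intro h0
      apply h1
      rw [← h0]
      refine Finset.sum_congr rfl fun i _ => ?_
      rw [hV, if_neg hp, mul_comm]
  have hGinj : ∀ b, G *ᵥ b = 0 → b = 0 := by
    intro b hb
    have h1 : (fun j => (∑ i, (h i : ℂ) * V i j) * b j) = 0 := by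
      refine Matrix.eq_zero_of_forall_pow_sum_mul_pow_eq_zero (f := μ) hμinj fun k => ?_
      have h2 := congrFun hb ⟨k.val, lt_of_lt_of_le k.isLt hMd⟩
      rw [Matrix.mulVec, dotProduct, Pi.zero_apply] at h2
      rw [← h2]
      refine Finset.sum_congr rfl fun j _ => ?_
      rw [hG]; ring
    ext j
    exact (mul_eq_zero.mp (congrFun h1 j)).resolve_left (hc j)
  obtain ⟨b, hb, hB⟩ := takens_aux V G hVinj
  obtain ⟨a, ha, hA⟩ := takens_aux G V hGinj
  set c := a⁻¹ with hcdef
  have hcpos : 0 < c := inv_pos.mpr ha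
  set e := max b c with he
  have hce : c ≤ e := le_max_right _ _
  have hbe : b ≤ e := le_max_left _ _
  have hC1 : (c + e) / 2 * (1 - (e - c) / (c + e)) = c := by
    have : c + e ≠ 0 := by linarith
    field_simp; ring
  have hC2 : (c + e) / 2 * (1 + (e - c) / (c + e)) = e := by
    have : c + e ≠ 0 := by linarith
    field_simp; ring
  refine ⟨(c + e) / 2, (e - c) / (c + e), by linarith, div_nonneg (by linarith) (by linarith),
    (div_lt_one (by linarith)).mpr (by linarith), fun tx ty _ => ?_⟩
  rw [hC1, hC2]
  set w : Fin (2 * d) → ℂ := fun j => Complex.exp (lam j * (tx : ℂ)) * α₀ j -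
    Complex.exp (lam j * (ty : ℂ)) * α₀ j with hw
  have e1 : ∀ i, X tx i - X ty i = (V *ᵥ w) i := by
    intro i
    rw [hX, hX, ← Finset.sum_sub_distrib]
    simp only [Matrix.mulVec, dotProduct, hw, mul_sub]
  have e2 : ∀ i, FX tx i - FX ty i = (G *ᵥ w) i := by
    intro i
    rw [hFX, hFX, ← Finset.sum_sub_distrib]
    simp only [Matrix.mulVec, dotProduct, hw, mul_sub]
  simp only [e1, e2]
  constructor
  · rw [hcdef, inv_mul_le_iff₀ ha]
    exact hA w
  · refine (hB w).trans ?_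
    gcongr
end

section
/- Suppose ‖h‖₂² = 2d/M, M > (2d−1)·(A₂κ₂²/(A₁κ₁²))·ν, the A_Φ-eigenvalues e^{±iθ_iT_s} are pairwise distinct and each has nonzero imaginary part, and v_i^H h ≠ 0 for all i = 1,…,d. Define C = d(κ₁²/A₂ + κ₂²/A₁), δ₀ = (A₂κ₂² − A₁κ₁²)/(A₂κ₂² + A₁κ₁²), δ₁(M) = ((2d−1)ν/M)·(2A₂κ₂²/(A₂κ₂² + A₁κ₁²)), and δ = δ₀ + δ₁(M). Then δ < 1 and for all x, y ∈ 𝓜 with x ≠ y, C(1−δ)·‖x−y‖₂² ≤ ‖F(x)−F(y)‖₂² ≤ C(1+δ)·‖x−y‖₂². (Stable Linear Takens' Embedding Theorem.) -/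
open Complex Matrix Finset

lemma aux_sum_sq {m : ℕ} (y : Fin m → ℂ) : ((∑ i, ‖y i‖ ^ 2 : ℝ) : ℂ) = star y ⬝ᵥ y := by
  simp [dotProduct, Complex.conj_mul']

lemma aux_quad {m n : ℕ} (V : Matrix (Fin m) (Fin n) ℂ) (hH : (Vᴴ * V).IsHermitian)
    (β : Fin n → ℂ) : ∃ y : Fin n → ℂ, (∑ i, ‖y i‖ ^ 2 = ∑ i, ‖β i‖ ^ 2) ∧
      ∑ i, ‖(V *ᵥ β) i‖ ^ 2 = ∑ i, hH.eigenvalues i * ‖y i‖ ^ 2 := by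
  set U : Matrix (Fin n) (Fin n) ℂ := (hH.eigenvectorUnitary : Matrix (Fin n) (Fin n) ℂ) with hU
  have hUU : U * star U = 1 := Unitary.coe_mul_star_self _
  have hsp : Vᴴ * V = U * diagonal (fun i => (hH.eigenvalues i : ℂ)) * star U := by
    have := hH.spectral_theorem
    rw [Unitary.conjStarAlgAut_apply] at this
    exact this
  have hstar : star (star U *ᵥ β) = star β ᵥ* U := by
    rw [star_mulVec, ← star_eq_conjTranspose, star_star]
  refine ⟨star U *ᵥ β, ?_, ?_⟩
  · apply Complex.ofReal_injective
    rw [aux_sum_sq, aux_sum_sq, hstar, ← dotProduct_mulVec, mulVec_mulVec, hUU, one_mulVec]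
  · apply Complex.ofReal_injective
    have hsp' := congrArg (fun A => A *ᵥ β) hsp
    rw [aux_sum_sq, star_mulVec, ← dotProduct_mulVec, mulVec_mulVec, hsp', ← mulVec_mulVec,
      ← mulVec_mulVec, dotProduct_mulVec, ← hstar]
    simp only [dotProduct, mulVec_diagonal]
    push_cast
    refine Finset.sum_congr rfl fun i _ => ?_
    rw [← Complex.conj_mul']
    simp only [Pi.star_apply, RCLike.star_def]
    ring

open scoped ComplexOrder in
lemma aux_eig_pos {m n : ℕ} (V : Matrix (Fin m) (Fin n) ℂ) (hH : (Vᴴ * V).IsHermitian)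
    (hr : V.rank = n) (i) : 0 < hH.eigenvalues i := by
  have hinj : Function.Injective V.mulVec := by
    have h1 := V.mulVecLin.finrank_range_add_finrank_ker
    rw [Matrix.rank] at hr
    rw [hr] at h1
    simp at h1
    have : LinearMap.ker V.mulVecLin = ⊥ := by
      simpa using h1
    exact LinearMap.ker_eq_bot.1 this
  exact (PosDef.conjTranspose_mul_self V hinj).eigenvalues_pos i

lemma aux_geom (M : ℕ) (z : ℂ) (hz : ‖z‖ = 1) (x : ℝ) (hx : z = Complex.exp (I * x))
    (h1 : z ≠ 1) : ‖∑ k : Fin M, z ^ (k : ℕ)‖ ≤ 1 / |Real.sin (x / 2)| := by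
  have h2 : ‖z - 1‖ = 2 * |Real.sin (x / 2)| := by
    rw [hx, Complex.norm_exp_I_mul_ofReal_sub_one]; simp
  have h3 : 0 < ‖z - 1‖ := norm_pos_iff.2 (sub_ne_zero.2 h1)
  have h4 : 0 < |Real.sin (x / 2)| := by linarith
  rw [Fin.sum_univ_eq_sum_range (fun k => z ^ k), le_div_iff₀ h4]
  have h5 : ‖∑ k ∈ range M, z ^ k‖ * ‖z - 1‖ ≤ 2 := by
    rw [← norm_mul, geom_sum_mul]
    calc ‖z ^ M - 1‖ ≤ ‖z ^ M‖ + ‖(1:ℂ)‖ := norm_sub_le _ _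
      _ = 2 := by rw [norm_pow, hz]; norm_num
  rw [h2] at h5
  linarith

lemma aux_gram (M n : ℕ) (w μ : Fin n → ℂ) (hμ : ∀ j, ‖μ j‖ = 1) (ν : ℝ) (hν : 0 ≤ ν)
    (hb : ∀ j l, j ≠ l → ‖∑ k : Fin M, (μ j * (starRingEnd ℂ) (μ l)) ^ (k : ℕ)‖ ≤ ν) :
    |∑ k : Fin M, ‖∑ j, w j * μ j ^ (k : ℕ)‖ ^ 2 - M * ∑ j, ‖w j‖ ^ 2|
      ≤ (n - 1) * ν * ∑ j, ‖w j‖ ^ 2 := by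
  have key : ((∑ k : Fin M, ‖∑ j, w j * μ j ^ (k : ℕ)‖ ^ 2 : ℝ) : ℂ)
      = ∑ j, ∑ l, (w j * (starRingEnd ℂ) (w l)) *
          ∑ k : Fin M, (μ j * (starRingEnd ℂ) (μ l)) ^ (k : ℕ) := by
    push_cast
    simp only [← Complex.mul_conj', map_sum, map_mul, map_pow]
    simp only [Finset.sum_mul_sum]
    simp only [Finset.mul_sum]
    rw [Finset.sum_comm]
    refine Finset.sum_congr rfl fun j _ => ?_
    rw [Finset.sum_comm]
    refine Finset.sum_congr rfl fun l _ => Finset.sum_congr rfl fun k _ => ?_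
    rw [mul_pow]; ring
  have hdiag : ((M * ∑ j, ‖w j‖ ^ 2 : ℝ) : ℂ) = ∑ j, ∑ l, if j = l then
      (w j * (starRingEnd ℂ) (w l)) *
          ∑ k : Fin M, (μ j * (starRingEnd ℂ) (μ l)) ^ (k : ℕ) else 0 := by
    push_cast
    rw [Finset.mul_sum]
    refine Finset.sum_congr rfl fun j _ => ?_
    simp [Complex.mul_conj', hμ, mul_comm]
  have h1 : |∑ k : Fin M, ‖∑ j, w j * μ j ^ (k : ℕ)‖ ^ 2 - M * ∑ j, ‖w j‖ ^ 2|
      ≤ ∑ j, ∑ l, (if j = l then 0 else ‖w j‖ * ‖w l‖ * ν) := by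
    rw [← Real.norm_eq_abs, ← Complex.norm_real, Complex.ofReal_sub, key, hdiag,
      ← Finset.sum_sub_distrib]
    refine (norm_sum_le _ _).trans (Finset.sum_le_sum fun j _ => ?_)
    rw [← Finset.sum_sub_distrib]
    refine (norm_sum_le _ _).trans (Finset.sum_le_sum fun l _ => ?_)
    split_ifs with hjl
    · simp
    · rw [sub_zero, norm_mul, norm_mul, RCLike.norm_conj]
      exact mul_le_mul_of_nonneg_left (hb j l hjl) (by positivity)
  refine h1.trans ?_
  have h2 : ∑ j, ∑ l, (if j = l then 0 else ‖w j‖ * ‖w l‖ * ν)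
      = ν * ((∑ j, ‖w j‖) ^ 2 - ∑ j, ‖w j‖ ^ 2) := by
    have : ∀ j l, (if j = l then 0 else ‖w j‖ * ‖w l‖ * ν) =
        ν * (‖w j‖ * ‖w l‖) - (if j = l then ν * (‖w j‖ * ‖w l‖) else 0) := by
      intro j l; split_ifs <;> ring
    simp only [this, Finset.sum_sub_distrib, Finset.sum_ite_eq, Finset.mem_univ, if_true]
    rw [sq, Finset.sum_mul_sum, mul_sub, Finset.mul_sum, Finset.mul_sum]
    simp only [Finset.mul_sum, sq]
  rw [h2]
  have h3 := sq_sum_le_card_mul_sum_sq (s := (Finset.univ : Finset (Fin n))) (f := fun j => ‖w j‖)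
  simp only [Finset.card_univ, Fintype.card_fin] at h3
  nlinarith

lemma aux_final (d : ℕ) (hd : 0 < d) (M κ₁ κ₂ A₁ A₂ ν C δ₀ δ₁ δ : ℝ) (hM : 0 < M) (hκ₁ : 0 < κ₁)
    (hκ : κ₁ ≤ κ₂) (hA₁ : 0 < A₁) (hA : A₁ ≤ A₂) (hν : 0 ≤ ν)
    (hMbig : M > (2 * (d : ℝ) - 1) * (A₂ * κ₂ ^ 2 / (A₁ * κ₁ ^ 2)) * ν)
    (hCdef : C = (d : ℝ) * (κ₁ ^ 2 / A₂ + κ₂ ^ 2 / A₁))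
    (hδ₀def : δ₀ = (A₂ * κ₂ ^ 2 - A₁ * κ₁ ^ 2) / (A₂ * κ₂ ^ 2 + A₁ * κ₁ ^ 2))
    (hδ₁def : δ₁ = ((2 * (d : ℝ) - 1) * ν / M) *
      (2 * A₂ * κ₂ ^ 2 / (A₂ * κ₂ ^ 2 + A₁ * κ₁ ^ 2)))
    (hδdef : δ = δ₀ + δ₁) :
    δ < 1 ∧ ∀ x b S f : ℝ, 0 ≤ b → A₁ * b ≤ x → x ≤ A₂ * b →
      κ₁ ^ 2 * (2 * d / M) * b ≤ S → S ≤ κ₂ ^ 2 * (2 * d / M) * b →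
      |f - M * S| ≤ (2 * d - 1) * ν * S → C * (1 - δ) * x ≤ f ∧ f ≤ C * (1 + δ) * x := by
  have hA₂ : 0 < A₂ := by linarith
  have hκ₂ : 0 < κ₂ := by linarith
  have hd1 : (1 : ℝ) ≤ d := by exact_mod_cast hd
  obtain ⟨ε, hε⟩ : ∃ ε, ε = (2 * (d : ℝ) - 1) * ν / M := ⟨_, rfl⟩
  have hε0 : 0 ≤ ε := by
    rw [hε]; exact div_nonneg (mul_nonneg (by linarith) hν) hM.le
  have hεM : (2 * (d : ℝ) - 1) * ν = ε * M := by rw [hε]; field_simp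
  have hsum : 0 < A₂ * κ₂ ^ 2 + A₁ * κ₁ ^ 2 := by positivity
  have hsmall : ε * (A₂ * κ₂ ^ 2) < A₁ * κ₁ ^ 2 := by
    have h1 : (2 * (d : ℝ) - 1) * (A₂ * κ₂ ^ 2 / (A₁ * κ₁ ^ 2)) * ν
        = M * (ε * (A₂ * κ₂ ^ 2)) / (A₁ * κ₁ ^ 2) := by
      rw [hε]; field_simp
    rw [h1, gt_iff_lt, div_lt_iff₀ (by positivity)] at hMbig
    exact lt_of_mul_lt_mul_left hMbig hM.le
  rw [← hε] at hδ₁def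
  have hδ : δ = (A₂ * κ₂ ^ 2 - A₁ * κ₁ ^ 2 + ε * (2 * A₂ * κ₂ ^ 2)) /
      (A₂ * κ₂ ^ 2 + A₁ * κ₁ ^ 2) := by
    rw [hδdef, hδ₀def, hδ₁def]; ring
  have hup : C * (1 + δ) = 2 * d * (1 + ε) * κ₂ ^ 2 / A₁ := by
    rw [hCdef, hδ]; field_simp; ring
  have hlo : C * (1 - δ) = 2 * d * (κ₁ ^ 2 / A₂ - ε * (κ₂ ^ 2 / A₁)) := by
    rw [hCdef, hδ]; field_simp; ring
  refine ⟨?_, ?_⟩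
  · rw [hδ, div_lt_one hsum]; linarith
  intro x b S f hb hx1 hx2 hS1 hS2 hf
  rw [hεM] at hf
  obtain ⟨hf1, hf2⟩ := abs_le.1 hf
  have hMS1 : 2 * d * κ₁ ^ 2 * b ≤ M * S := by
    have := mul_le_mul_of_nonneg_left hS1 hM.le
    have e : M * (κ₁ ^ 2 * (2 * d / M) * b) = 2 * d * κ₁ ^ 2 * b := by field_simp
    linarith
  have hMS2 : M * S ≤ 2 * d * κ₂ ^ 2 * b := by
    have := mul_le_mul_of_nonneg_left hS2 hM.le
    have e : M * (κ₂ ^ 2 * (2 * d / M) * b) = 2 * d * κ₂ ^ 2 * b := by field_simp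
    linarith
  have hb1 : b ≤ x / A₁ := by rw [le_div_iff₀ hA₁]; linarith
  have hb2 : x / A₂ ≤ b := by rw [div_le_iff₀ hA₂]; linarith
  have hl : 2 * d * κ₁ ^ 2 * (x / A₂) ≤ M * S :=
    (mul_le_mul_of_nonneg_left hb2 (by positivity)).trans hMS1
  have hu : M * S ≤ 2 * d * κ₂ ^ 2 * (x / A₁) :=
    hMS2.trans (mul_le_mul_of_nonneg_left hb1 (by positivity))
  have hεu := mul_le_mul_of_nonneg_left hu hε0
  rw [hup, hlo]
  constructor
  · have e : 2 * d * (κ₁ ^ 2 / A₂ - ε * (κ₂ ^ 2 / A₁)) * x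
        = 2 * d * κ₁ ^ 2 * (x / A₂) - ε * (2 * d * κ₂ ^ 2 * (x / A₁)) := by ring
    rw [e]; linarith
  · have e : 2 * d * (1 + ε) * κ₂ ^ 2 / A₁ * x
        = 2 * d * κ₂ ^ 2 * (x / A₁) + ε * (2 * d * κ₂ ^ 2 * (x / A₁)) := by ring
    rw [e]; linarith

/-- Stable Linear Takens' Embedding Theorem: if `‖h‖₂² = 2d/M`,
`M > (2d−1)(A₂κ₂²/(A₁κ₁²))ν`, the `A_Φ`-eigenvalues are pairwise distinct with
nonzero imaginary parts, and `v_i^H h ≠ 0` for all `i`, then with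
`C = d(κ₁²/A₂ + κ₂²/A₁)` and `δ = δ₀ + δ₁(M)` we have `δ < 1` and
`C(1−δ)‖x−y‖₂² ≤ ‖F(x)−F(y)‖₂² ≤ C(1+δ)‖x−y‖₂²` for all distinct `x, y ∈ 𝓜`. -/
theorem stmt1
    (N d M : ℕ) (hN : 0 < N) (hd : 0 < d) (hMpos : 0 < M) (hdN : 2 * d ≤ N)
    (θ : Fin d → ℝ) (hθpos : ∀ i, 0 < θ i) (hθinj : Function.Injective θ)
    (Ts : ℝ) (hTs : 0 < Ts)
    (v : Fin d → Fin N → ℂ) (hvnorm : ∀ p, ∑ i, ‖v p i‖ ^ 2 = 1)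
    (V : Matrix (Fin N) (Fin (2 * d)) ℂ)
    (hV : ∀ (i : Fin N) (j : Fin (2 * d)),
      V i j = if j.val % 2 = 0
        then v ⟨j.val / 2, by have := j.isLt; omega⟩ i
        else (starRingEnd ℂ) (v ⟨j.val / 2, by have := j.isLt; omega⟩ i))
    (hVrank : V.rank = 2 * d)
    (h : Fin N → ℝ) (hh : h ≠ 0)
    (μ : Fin (2 * d) → ℂ)
    (hμ : ∀ j : Fin (2 * d),
      μ j = if j.val % 2 = 0
        then Complex.exp (-((θ ⟨j.val / 2, by have := j.isLt; omega⟩ * Ts : ℝ) : ℂ) * Complex.I)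
        else Complex.exp (((θ ⟨j.val / 2, by have := j.isLt; omega⟩ * Ts : ℝ) : ℂ) * Complex.I))
    (G : Matrix (Fin M) (Fin (2 * d)) ℂ)
    (hG : ∀ (k : Fin M) (j : Fin (2 * d)), G k j = (∑ i, (h i : ℂ) * V i j) * μ j ^ (k : ℕ))
    (vh : Fin d → ℂ) (hvhdef : ∀ p, vh p = ∑ i, (starRingEnd ℂ) (v p i) * (h i : ℂ))
    (α₀ : Fin (2 * d) → ℂ)
    (lam : Fin (2 * d) → ℂ)
    (hlam : ∀ j : Fin (2 * d),
      lam j = if j.val % 2 = 0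
        then ((θ ⟨j.val / 2, by have := j.isLt; omega⟩ : ℝ) : ℂ) * Complex.I
        else -(((θ ⟨j.val / 2, by have := j.isLt; omega⟩ : ℝ) : ℂ)) * Complex.I)
    (X : ℝ → Fin N → ℂ)
    (hX : ∀ (t : ℝ) (i : Fin N), X t i = ∑ j, V i j * (Complex.exp (lam j * (t : ℂ)) * α₀ j))
    (FX : ℝ → Fin M → ℂ)
    (hFX : ∀ (t : ℝ) (k : Fin M), FX t k = ∑ j, G k j * (Complex.exp (lam j * (t : ℂ)) * α₀ j))
    (hne : (Finset.univ : Finset (Fin d)).Nonempty)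
    (κ₁ κ₂ : ℝ)
    (hκ₁def : κ₁ = Finset.univ.inf' hne fun p => ‖vh p‖ / Real.sqrt (∑ i, h i ^ 2))
    (hκ₂def : κ₂ = Finset.univ.sup' hne fun p => ‖vh p‖ / Real.sqrt (∑ i, h i ^ 2))
    (ν : ℝ)
    (hνdef : ν = sSup ({r : ℝ | ∃ p : Fin d, r = 1 / |Real.sin (θ p * Ts)|} ∪
      {r : ℝ | ∃ p q : Fin d, p ≠ q ∧
        (r = 1 / |Real.sin ((θ p - θ q) * Ts / 2)| ∨
         r = 1 / |Real.sin ((θ p + θ q) * Ts / 2)|)}))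
    (hHermV : (Vᴴ * V).IsHermitian) (A₁ A₂ : ℝ)
    (hA₁def : A₁ = ⨅ i, hHermV.eigenvalues i)
    (hA₂def : A₂ = ⨆ i, hHermV.eigenvalues i)
    (hμinj : Function.Injective μ) (hμim : ∀ j, (μ j).im ≠ 0)
    (hvh : ∀ p, vh p ≠ 0)
    (hhnorm : ∑ i, h i ^ 2 = 2 * (d : ℝ) / (M : ℝ))
    (hMbig : (M : ℝ) > (2 * (d : ℝ) - 1) * (A₂ * κ₂ ^ 2 / (A₁ * κ₁ ^ 2)) * ν)
    (C δ₀ δ₁ δ : ℝ)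
    (hCdef : C = (d : ℝ) * (κ₁ ^ 2 / A₂ + κ₂ ^ 2 / A₁))
    (hδ₀def : δ₀ = (A₂ * κ₂ ^ 2 - A₁ * κ₁ ^ 2) / (A₂ * κ₂ ^ 2 + A₁ * κ₁ ^ 2))
    (hδ₁def : δ₁ = ((2 * (d : ℝ) - 1) * ν / (M : ℝ)) *
      (2 * A₂ * κ₂ ^ 2 / (A₂ * κ₂ ^ 2 + A₁ * κ₁ ^ 2)))
    (hδdef : δ = δ₀ + δ₁) :
    δ < 1 ∧
      ∀ tx ty : ℝ, X tx ≠ X ty →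
        C * (1 - δ) * (∑ i, ‖X tx i - X ty i‖ ^ 2) ≤ ∑ k, ‖FX tx k - FX ty k‖ ^ 2 ∧
        ∑ k, ‖FX tx k - FX ty k‖ ^ 2 ≤ C * (1 + δ) * (∑ i, ‖X tx i - X ty i‖ ^ 2) := by
  have hMr : (0 : ℝ) < M := by exact_mod_cast hMpos
  have hdr : (0 : ℝ) < d := by exact_mod_cast hd
  have hH2 : 0 < ∑ i, h i ^ 2 := by rw [hhnorm]; positivity
  have hH0 : 0 < Real.sqrt (∑ i, h i ^ 2) := Real.sqrt_pos.2 hH2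
  -- kappa
  have hk1 : ∀ p, κ₁ ≤ ‖vh p‖ / Real.sqrt (∑ i, h i ^ 2) := fun p => by
    rw [hκ₁def]
    exact Finset.inf'_le (fun p => ‖vh p‖ / Real.sqrt (∑ i, h i ^ 2)) (Finset.mem_univ p)
  have hk2 : ∀ p, ‖vh p‖ / Real.sqrt (∑ i, h i ^ 2) ≤ κ₂ := fun p => by
    rw [hκ₂def]
    exact Finset.le_sup' (fun p => ‖vh p‖ / Real.sqrt (∑ i, h i ^ 2)) (Finset.mem_univ p)
  have hκ₁pos : 0 < κ₁ := by
    rw [hκ₁def, Finset.lt_inf'_iff]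
    intro p _
    exact div_pos (norm_pos_iff.2 (hvh p)) hH0
  have hκ : κ₁ ≤ κ₂ := (hk1 ⟨0, hd⟩).trans (hk2 ⟨0, hd⟩)
  -- eigenvalues
  have hne2 : Nonempty (Fin (2 * d)) := ⟨⟨0, by omega⟩⟩
  have ha1 : ∀ i, A₁ ≤ hHermV.eigenvalues i := fun i => by
    rw [hA₁def]; exact ciInf_le (Set.finite_range _).bddBelow i
  have ha2 : ∀ i, hHermV.eigenvalues i ≤ A₂ := fun i => by
    rw [hA₂def]; exact le_ciSup (Set.finite_range _).bddAbove i
  have hA₁pos : 0 < A₁ := by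
    obtain ⟨i, hi⟩ := exists_eq_ciInf_of_finite (f := hHermV.eigenvalues)
    rw [hA₁def, ← hi]
    exact aux_eig_pos V hHermV hVrank i
  have hA : A₁ ≤ A₂ := (ha1 ⟨0, by omega⟩).trans (ha2 _)
  -- nu
  have hbdd : BddAbove ({r : ℝ | ∃ p : Fin d, r = 1 / |Real.sin (θ p * Ts)|} ∪
      {r : ℝ | ∃ p q : Fin d, p ≠ q ∧
        (r = 1 / |Real.sin ((θ p - θ q) * Ts / 2)| ∨
         r = 1 / |Real.sin ((θ p + θ q) * Ts / 2)|)}) := by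
    refine Set.Finite.bddAbove (Set.Finite.union ?_ ?_)
    · refine (Set.finite_range (fun p : Fin d => 1 / |Real.sin (θ p * Ts)|)).subset ?_
      rintro r ⟨p, rfl⟩
      exact ⟨p, rfl⟩
    · refine ((Set.finite_range (fun p : Fin d × Fin d =>
        1 / |Real.sin ((θ p.1 - θ p.2) * Ts / 2)|)).union (Set.finite_range
        (fun p : Fin d × Fin d => 1 / |Real.sin ((θ p.1 + θ p.2) * Ts / 2)|))).subset ?_
      rintro r ⟨p, q, _, rfl | rfl⟩
      · exact Or.inl ⟨(p, q), rfl⟩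
      · exact Or.inr ⟨(p, q), rfl⟩
  have hn1 : ∀ p, 1 / |Real.sin (θ p * Ts)| ≤ ν := fun p => by
    rw [hνdef]; exact le_csSup hbdd (Or.inl ⟨p, rfl⟩)
  have hn2 : ∀ p q, p ≠ q → 1 / |Real.sin ((θ p - θ q) * Ts / 2)| ≤ ν := fun p q hpq => by
    rw [hνdef]; exact le_csSup hbdd (Or.inr ⟨p, q, hpq, Or.inl rfl⟩)
  have hn3 : ∀ p q, p ≠ q → 1 / |Real.sin ((θ p + θ q) * Ts / 2)| ≤ ν := fun p q hpq => by
    rw [hνdef]; exact le_csSup hbdd (Or.inr ⟨p, q, hpq, Or.inr rfl⟩)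
  have hν0 : 0 ≤ ν := le_trans (by positivity) (hn1 ⟨0, hd⟩)
  -- phases
  obtain ⟨P, hP⟩ : ∃ P : Fin (2 * d) → Fin d, ∀ j, P j = ⟨j.val / 2, by have := j.isLt; omega⟩ :=
    ⟨_, fun j => rfl⟩
  simp only [← hP] at hμ hV
  obtain ⟨φ, hφ⟩ : ∃ φ : Fin (2 * d) → ℝ, ∀ j, φ j =
      if j.val % 2 = 0 then -(θ (P j) * Ts) else θ (P j) * Ts := ⟨_, fun j => rfl⟩
  have hμφ : ∀ j, μ j = Complex.exp (I * φ j) := by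
    intro j
    rw [hμ, hφ]
    split_ifs <;> (push_cast; congr 1; ring)
  have hμ1 : ∀ j, ‖μ j‖ = 1 := by
    intro j
    rw [hμφ, mul_comm, Complex.norm_exp_ofReal_mul_I]
  have hsinb : ∀ j l, j ≠ l → 1 / |Real.sin ((φ j - φ l) / 2)| ≤ ν := by
    intro j l hjl
    by_cases hpq : P j = P l
    · have hpq' := hpq
      rw [hP, hP, Fin.mk.injEq] at hpq'
      have hv : j.val ≠ l.val := fun e => hjl (Fin.ext e)
      rw [hφ, hφ, hpq]
      have := hn1 (P l)
      split_ifs with h1 h2 h2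
      · omega
      · rw [show (-(θ (P l) * Ts) - θ (P l) * Ts) / 2 = -(θ (P l) * Ts) by ring,
          Real.sin_neg, abs_neg]
        exact this
      · rw [show (θ (P l) * Ts - -(θ (P l) * Ts)) / 2 = (θ (P l) * Ts) by ring]
        exact this
      · omega
    · have h2 := hn2 _ _ hpq
      have h3 := hn3 _ _ hpq
      rw [hφ, hφ]
      split_ifs
      · rw [show (-(θ (P j) * Ts) - -(θ (P l) * Ts)) / 2 = -((θ (P j) - θ (P l)) * Ts / 2) by ring,
          Real.sin_neg, abs_neg]
        exact h2
      · rw [show (-(θ (P j) * Ts) - (θ (P l) * Ts)) / 2 = -((θ (P j) + θ (P l)) * Ts / 2) by ring,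
          Real.sin_neg, abs_neg]
        exact h3
      · rw [show ((θ (P j) * Ts) - -(θ (P l) * Ts)) / 2 = ((θ (P j) + θ (P l)) * Ts / 2) by ring]
        exact h3
      · rw [show ((θ (P j) * Ts) - (θ (P l) * Ts)) / 2 = ((θ (P j) - θ (P l)) * Ts / 2) by ring]
        exact h2
  have hb : ∀ j l, j ≠ l →
      ‖∑ k : Fin M, (μ j * (starRingEnd ℂ) (μ l)) ^ (k : ℕ)‖ ≤ ν := by
    intro j l hjl
    refine (aux_geom M _ ?_ (φ j - φ l) ?_ ?_).trans (hsinb j l hjl)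
    · rw [norm_mul, RCLike.norm_conj, hμ1, hμ1, one_mul]
    · rw [hμφ, hμφ, ← Complex.exp_conj, ← Complex.exp_add]
      congr 1
      simp
      ring
    · intro he
      apply hjl
      apply hμinj
      have h1 : (starRingEnd ℂ) (μ l) * μ l = 1 := by
        rw [Complex.conj_mul', hμ1]; simp
      calc μ j = μ j * ((starRingEnd ℂ) (μ l) * μ l) := by rw [h1, mul_one]
        _ = μ l := by rw [← mul_assoc, he, one_mul]
  -- observation coefficients
  obtain ⟨c, hc⟩ : ∃ c : Fin (2 * d) → ℂ, ∀ j, c j = ∑ i, (h i : ℂ) * V i j := ⟨_, fun j => rfl⟩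
  have hcn : ∀ j, ‖c j‖ = ‖vh (P j)‖ := by
    intro j
    rw [hc, hvhdef]
    simp only [hV]
    split_ifs
    · rw [← RCLike.norm_conj, map_sum]
      simp [mul_comm]
    · simp [mul_comm]
  have hc1 : ∀ j, κ₁ ^ 2 * (2 * d / M) ≤ ‖c j‖ ^ 2 := by
    intro j
    have h1 := hk1 (P j)
    rw [← hcn, le_div_iff₀ hH0] at h1
    rw [← hhnorm, ← Real.sq_sqrt hH2.le, ← mul_pow]
    exact pow_le_pow_left₀ (by positivity) h1 2
  have hc2 : ∀ j, ‖c j‖ ^ 2 ≤ κ₂ ^ 2 * (2 * d / M) := by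
    intro j
    have h1 := hk2 (P j)
    rw [← hcn, div_le_iff₀ hH0] at h1
    rw [← hhnorm, ← Real.sq_sqrt hH2.le, ← mul_pow]
    exact pow_le_pow_left₀ (by positivity) h1 2
  obtain ⟨hδ1, hmain⟩ := aux_final d hd M κ₁ κ₂ A₁ A₂ ν C δ₀ δ₁ δ hMr hκ₁pos hκ hA₁pos hA hν0
    hMbig hCdef hδ₀def hδ₁def hδdef
  refine ⟨hδ1, fun tx ty _ => ?_⟩
  obtain ⟨β, hβ⟩ : ∃ β : Fin (2 * d) → ℂ, ∀ j, β j =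
      Complex.exp (lam j * (tx : ℂ)) * α₀ j - Complex.exp (lam j * (ty : ℂ)) * α₀ j :=
    ⟨_, fun j => rfl⟩
  have hXd : ∀ i, X tx i - X ty i = (V *ᵥ β) i := by
    intro i
    rw [hX, hX, ← Finset.sum_sub_distrib]
    simp only [mulVec, dotProduct, hβ, mul_sub]
  have hFd : ∀ k, FX tx k - FX ty k = ∑ j, (c j * β j) * μ j ^ (k : ℕ) := by
    intro k
    rw [hFX, hFX, ← Finset.sum_sub_distrib]
    refine Finset.sum_congr rfl fun j _ => ?_
    rw [hG, hβ, hc]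
    ring
  simp only [hXd, hFd]
  obtain ⟨y, hy1, hy2⟩ := aux_quad V hHermV β
  refine hmain _ (∑ j, ‖β j‖ ^ 2) (∑ j, ‖c j * β j‖ ^ 2) _ (by positivity) ?_ ?_ ?_ ?_ ?_
  · rw [hy2, ← hy1, Finset.mul_sum]
    exact Finset.sum_le_sum fun i _ => mul_le_mul_of_nonneg_right (ha1 i) (by positivity)
  · rw [hy2, ← hy1, Finset.mul_sum]
    exact Finset.sum_le_sum fun i _ => mul_le_mul_of_nonneg_right (ha2 i) (by positivity)
  · rw [Finset.mul_sum]
    refine Finset.sum_le_sum fun i _ => ?_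
    rw [norm_mul, mul_pow]
    exact mul_le_mul_of_nonneg_right (hc1 i) (by positivity)
  · rw [Finset.mul_sum]
    refine Finset.sum_le_sum fun i _ => ?_
    rw [norm_mul, mul_pow]
    exact mul_le_mul_of_nonneg_right (hc2 i) (by positivity)
  · have := aux_gram M (2 * d) (fun j => c j * β j) μ hμ1 ν hν0 hb
    push_cast at this
    exact this
end

section
/- Suppose the A_Φ-eigenvalues e^{±iθ_iT_s} are pairwise distinct and each has nonzero imaginary part. Then for each i = 1,…,d: (i) the diagonal entries of G^H G in positions (2i−1, 2i−1) and (2i, 2i) both equal M·|v_i^H h|²; and (ii) the sum of the absolute values of the off-diagonal entries of G^H G in row 2i−1 equals the corresponding sum in row 2i, and both equal |v_i^H h|²·|sin(Mθ_iT_s)/sin(θ_iT_s)| + Σ_{p≠i} |v_i^H h||v_p^H h|·|sin(M(θ_i−θ_p)T_s/2)/sin((θ_i−θ_p)T_s/2)| + Σ_{p≠i} |v_i^H h||v_p^H h|·|sin(M(θ_i+θ_p)T_s/2)/sin((θ_i+θ_p)T_s/2)|, where both sums run over p ∈ {1,…,d} with p ≠ i. (These are the centers and radii of the Gershgorin disks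 of G^H G.) -/
open Complex Matrix Finset

/-- Norm of the geometric sum on the unit circle. -/
theorem norm_geom_aux (M : ℕ) (x : ℝ) (hx : Complex.exp (((2 * x : ℝ) : ℂ) * Complex.I) ≠ 1) :
    ‖∑ m : Fin M, Complex.exp (((2 * x : ℝ) : ℂ) * Complex.I) ^ (m : ℕ)‖
      = |Real.sin ((M : ℝ) * x) / Real.sin x| := by
  have key : ∀ y : ℝ, ‖Complex.exp (((2 * y : ℝ) : ℂ) * Complex.I) - 1‖ = 2 * |Real.sin y| := by
    intro y
    rw [mul_comm, Complex.norm_exp_I_mul_ofReal_sub_one, norm_mul]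
    simp
  rw [Fin.sum_univ_eq_sum_range (fun m => Complex.exp (((2 * x : ℝ) : ℂ) * Complex.I) ^ m) M,
    geom_sum_eq hx, norm_div, key, ← Complex.exp_nat_mul]
  have : (M : ℂ) * (((2 * x : ℝ) : ℂ) * Complex.I)
      = ((2 * ((M : ℝ) * x) : ℝ) : ℂ) * Complex.I := by push_cast; ring
  rw [this, key, abs_div, mul_div_mul_left _ _ two_ne_zero]

theorem sin_ratio_neg (M : ℕ) (x : ℝ) :
    |Real.sin ((M : ℝ) * (-x)) / Real.sin (-x)| = |Real.sin ((M : ℝ) * x) / Real.sin x| := by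
  rw [mul_neg, Real.sin_neg, Real.sin_neg, neg_div_neg_eq]

/-- Splitting a sum over `Fin (2 * d)` into even and odd indices. -/
theorem sum_even_odd (d : ℕ) (F : Fin (2 * d) → ℝ) :
    ∑ j, F j = ∑ q : Fin d, (F ⟨2 * q.val, by have := q.isLt; omega⟩
      + F ⟨2 * q.val + 1, by have := q.isLt; omega⟩) := by
  rw [← Equiv.sum_comp (finProdFinEquiv.trans (finCongr (mul_comm d 2))) F,
    Fintype.sum_prod_type]
  refine Finset.sum_congr rfl fun q _ => ?_
  rw [Fin.sum_univ_two]
  congr 2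
  · ext; simp
  · ext; simp [add_comm]

/-- Gershgorin disks of `Gᴴ G`: the centers (diagonal entries) in 1-indexed
positions `(2i−1,2i−1)` and `(2i,2i)` both equal `M·|v_i^H h|²`, and the radii
(off-diagonal absolute row sums) of rows `2i−1` and `2i` coincide and are given
by the stated closed-form sine-ratio expression. -/
theorem stmt3
    (N d M : ℕ) (hN : 0 < N) (hd : 0 < d) (hMpos : 0 < M) (hdN : 2 * d ≤ N)
    (θ : Fin d → ℝ) (hθpos : ∀ i, 0 < θ i) (hθinj : Function.Injective θ)
    (Ts : ℝ) (hTs : 0 < Ts)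
    (v : Fin d → Fin N → ℂ) (hvnorm : ∀ p, ∑ i, ‖v p i‖ ^ 2 = 1)
    (V : Matrix (Fin N) (Fin (2 * d)) ℂ)
    (hV : ∀ (i : Fin N) (j : Fin (2 * d)),
      V i j = if j.val % 2 = 0
        then v ⟨j.val / 2, by have := j.isLt; omega⟩ i
        else (starRingEnd ℂ) (v ⟨j.val / 2, by have := j.isLt; omega⟩ i))
    (hVrank : V.rank = 2 * d)
    (h : Fin N → ℝ) (hh : h ≠ 0)
    (μ : Fin (2 * d) → ℂ)
    (hμ : ∀ j : Fin (2 * d),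
      μ j = if j.val % 2 = 0
        then Complex.exp (-((θ ⟨j.val / 2, by have := j.isLt; omega⟩ * Ts : ℝ) : ℂ) * Complex.I)
        else Complex.exp (((θ ⟨j.val / 2, by have := j.isLt; omega⟩ * Ts : ℝ) : ℂ) * Complex.I))
    (G : Matrix (Fin M) (Fin (2 * d)) ℂ)
    (hG : ∀ (k : Fin M) (j : Fin (2 * d)), G k j = (∑ i, (h i : ℂ) * V i j) * μ j ^ (k : ℕ))
    (vh : Fin d → ℂ) (hvhdef : ∀ p, vh p = ∑ i, (starRingEnd ℂ) (v p i) * (h i : ℂ))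
    (hμinj : Function.Injective μ) (hμim : ∀ j, (μ j).im ≠ 0) :
    ∀ p : Fin d,
      ((Gᴴ * G) ⟨2 * p.val, by have := p.isLt; omega⟩ ⟨2 * p.val, by have := p.isLt; omega⟩
          = (((M : ℝ) * ‖vh p‖ ^ 2 : ℝ) : ℂ) ∧
        (Gᴴ * G) ⟨2 * p.val + 1, by have := p.isLt; omega⟩ ⟨2 * p.val + 1, by have := p.isLt; omega⟩
          = (((M : ℝ) * ‖vh p‖ ^ 2 : ℝ) : ℂ)) ∧
      (∑ j ∈ Finset.univ.erase ⟨2 * p.val, by have := p.isLt; omega⟩,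
            ‖(Gᴴ * G) ⟨2 * p.val, by have := p.isLt; omega⟩ j‖)
        = (∑ j ∈ Finset.univ.erase ⟨2 * p.val + 1, by have := p.isLt; omega⟩,
            ‖(Gᴴ * G) ⟨2 * p.val + 1, by have := p.isLt; omega⟩ j‖) ∧
      (∑ j ∈ Finset.univ.erase ⟨2 * p.val, by have := p.isLt; omega⟩,
            ‖(Gᴴ * G) ⟨2 * p.val, by have := p.isLt; omega⟩ j‖)
        = ‖vh p‖ ^ 2 * |Real.sin ((M : ℝ) * (θ p * Ts)) / Real.sin (θ p * Ts)|
          + (∑ q ∈ Finset.univ.erase p, ‖vh p‖ * ‖vh q‖ *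
              |Real.sin ((M : ℝ) * ((θ p - θ q) * Ts / 2)) / Real.sin ((θ p - θ q) * Ts / 2)|)
          + ∑ q ∈ Finset.univ.erase p, ‖vh p‖ * ‖vh q‖ *
              |Real.sin ((M : ℝ) * ((θ p + θ q) * Ts / 2)) / Real.sin ((θ p + θ q) * Ts / 2)| := by
  have hE : ∀ j k, (Gᴴ * G) j k = (starRingEnd ℂ) (∑ i, (h i : ℂ) * V i j) *
      (∑ i, (h i : ℂ) * V i k) * ∑ m : Fin M, ((starRingEnd ℂ) (μ j) * μ k) ^ (m : ℕ) := by
    intro j k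
    rw [Matrix.mul_apply, Finset.mul_sum]
    refine Finset.sum_congr rfl fun m _ => ?_
    rw [Matrix.conjTranspose_apply, hG, hG, ← starRingEnd_apply, map_mul, map_pow, mul_pow]
    ring
  have ae : ∀ p : Fin d, ‖∑ i, (h i : ℂ) * V i ⟨2 * p.val, by have := p.isLt; omega⟩‖ = ‖vh p‖ := by
    intro p
    rw [hvhdef, ← Complex.norm_conj, map_sum]
    congr 1
    refine Finset.sum_congr rfl fun i _ => ?_
    rw [hV]
    simp [mul_comm]
  have ao : ∀ p : Fin d,
      ‖∑ i, (h i : ℂ) * V i ⟨2 * p.val + 1, by have := p.isLt; omega⟩‖ = ‖vh p‖ := by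
    intro p
    rw [hvhdef]
    congr 1
    refine Finset.sum_congr rfl fun i _ => ?_
    have h2 : (2 * p.val + 1) / 2 = p.val := by omega
    rw [hV, mul_comm]
    simp [Nat.add_mod, h2]
  have me : ∀ p : Fin d, μ ⟨2 * p.val, by have := p.isLt; omega⟩
      = Complex.exp (((-(θ p * Ts) : ℝ) : ℂ) * Complex.I) := by
    intro p
    rw [hμ]
    simp
  have mo : ∀ p : Fin d, μ ⟨2 * p.val + 1, by have := p.isLt; omega⟩
      = Complex.exp (((θ p * Ts : ℝ) : ℂ) * Complex.I) := by
    intro p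
    have h2 : (2 * p.val + 1) / 2 = p.val := by omega
    rw [hμ]
    simp [Nat.add_mod, h2]
  have hcm : ∀ x y : ℝ, (starRingEnd ℂ) (Complex.exp ((x : ℂ) * Complex.I)) *
      Complex.exp ((y : ℂ) * Complex.I)
      = Complex.exp (((2 * ((y - x) / 2) : ℝ) : ℂ) * Complex.I) := by
    intro x y
    rw [← Complex.exp_conj, ← Complex.exp_add]
    congr 1
    simp only [map_mul, Complex.conj_ofReal, Complex.conj_I]
    push_cast
    ring
  have hdiag : ∀ j (x r : ℝ), μ j = Complex.exp ((x : ℂ) * Complex.I) →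
      ‖∑ i, (h i : ℂ) * V i j‖ = r → (Gᴴ * G) j j = (((M : ℝ) * r ^ 2 : ℝ) : ℂ) := by
    intro j x r hx hr
    rw [hE, hx, hcm, Complex.conj_mul', hr]
    simp [mul_comm]
  have hoff : ∀ j k (x y r s : ℝ), j ≠ k → μ j = Complex.exp ((x : ℂ) * Complex.I) →
      μ k = Complex.exp ((y : ℂ) * Complex.I) →
      ‖∑ i, (h i : ℂ) * V i j‖ = r → ‖∑ i, (h i : ℂ) * V i k‖ = s →
      ‖(Gᴴ * G) j k‖ = r * s *
        |Real.sin ((M : ℝ) * ((y - x) / 2)) / Real.sin ((y - x) / 2)| := by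
    intro j k x y r s hjk hx hy hr hs
    rw [hE, norm_mul, norm_mul, Complex.norm_conj, hr, hs, hx, hy, hcm, norm_geom_aux]
    intro h1
    apply hjk
    apply hμinj
    rw [hx, hy]
    have h2 : Complex.exp ((y : ℂ) * Complex.I) = Complex.exp ((x : ℂ) * Complex.I) *
        Complex.exp (((2 * ((y - x) / 2) : ℝ) : ℂ) * Complex.I) := by
      rw [← Complex.exp_add]
      congr 1
      push_cast
      ring
    rw [h2, h1, mul_one]
  intro p
  have row1 : (∑ j ∈ Finset.univ.erase ⟨2 * p.val, by have := p.isLt; omega⟩,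
            ‖(Gᴴ * G) ⟨2 * p.val, by have := p.isLt; omega⟩ j‖)
        = ‖vh p‖ ^ 2 * |Real.sin ((M : ℝ) * (θ p * Ts)) / Real.sin (θ p * Ts)|
          + (∑ q ∈ Finset.univ.erase p, ‖vh p‖ * ‖vh q‖ *
              |Real.sin ((M : ℝ) * ((θ p - θ q) * Ts / 2)) / Real.sin ((θ p - θ q) * Ts / 2)|)
          + ∑ q ∈ Finset.univ.erase p, ‖vh p‖ * ‖vh q‖ *
              |Real.sin ((M : ℝ) * ((θ p + θ q) * Ts / 2)) / Real.sin ((θ p + θ q) * Ts / 2)| := by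
    rw [Finset.sum_erase_eq_sub (Finset.mem_univ _), sum_even_odd,
      ← Finset.add_sum_erase _ _ (Finset.mem_univ p), add_assoc (_ * _), ← Finset.sum_add_distrib]
    have h1 := hoff _ _ _ _ _ _ (by simp) (me p) (mo p) (ae p) (ao p)
    rw [show (θ p * Ts - -(θ p * Ts)) / 2 = θ p * Ts by ring] at h1
    rw [h1, add_sub_right_comm, add_sub_cancel_left, ← pow_two]
    congr 1
    refine Finset.sum_congr rfl fun q hq => ?_
    have hqp : p.val ≠ q.val := fun hh => Finset.ne_of_mem_erase hq (Fin.ext hh.symm)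
    rw [hoff _ _ _ _ _ _ (by simp; omega) (me p) (me q) (ae p) (ae q),
      hoff _ _ _ _ _ _ (by simp; omega) (me p) (mo q) (ae p) (ao q),
      show (-(θ q * Ts) - -(θ p * Ts)) / 2 = (θ p - θ q) * Ts / 2 by ring,
      show (θ q * Ts - -(θ p * Ts)) / 2 = (θ p + θ q) * Ts / 2 by ring]
  have row2 : (∑ j ∈ Finset.univ.erase ⟨2 * p.val + 1, by have := p.isLt; omega⟩,
            ‖(Gᴴ * G) ⟨2 * p.val + 1, by have := p.isLt; omega⟩ j‖)
        = ‖vh p‖ ^ 2 * |Real.sin ((M : ℝ) * (θ p * Ts)) / Real.sin (θ p * Ts)|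
          + (∑ q ∈ Finset.univ.erase p, ‖vh p‖ * ‖vh q‖ *
              |Real.sin ((M : ℝ) * ((θ p - θ q) * Ts / 2)) / Real.sin ((θ p - θ q) * Ts / 2)|)
          + ∑ q ∈ Finset.univ.erase p, ‖vh p‖ * ‖vh q‖ *
              |Real.sin ((M : ℝ) * ((θ p + θ q) * Ts / 2)) / Real.sin ((θ p + θ q) * Ts / 2)| := by
    rw [Finset.sum_erase_eq_sub (Finset.mem_univ _), sum_even_odd,
      ← Finset.add_sum_erase _ _ (Finset.mem_univ p), add_assoc (_ * _), ← Finset.sum_add_distrib]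
    have h1 := hoff _ _ _ _ _ _ (by simp) (mo p) (me p) (ao p) (ae p)
    rw [show (-(θ p * Ts) - θ p * Ts) / 2 = -(θ p * Ts) by ring, sin_ratio_neg] at h1
    rw [h1, add_sub_right_comm, add_sub_cancel_right, ← pow_two]
    congr 1
    refine Finset.sum_congr rfl fun q hq => ?_
    have hqp : p.val ≠ q.val := fun hh => Finset.ne_of_mem_erase hq (Fin.ext hh.symm)
    rw [hoff _ _ _ _ _ _ (by simp; omega) (mo p) (me q) (ao p) (ae q),
      hoff _ _ _ _ _ _ (by simp; omega) (mo p) (mo q) (ao p) (ao q),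
      show (-(θ q * Ts) - θ p * Ts) / 2 = -((θ p + θ q) * Ts / 2) by ring,
      show (θ q * Ts - θ p * Ts) / 2 = -((θ p - θ q) * Ts / 2) by ring,
      sin_ratio_neg, sin_ratio_neg, add_comm]
  exact ⟨⟨hdiag _ _ _ (me p) (ae p), hdiag _ _ _ (mo p) (ao p)⟩, row1.trans row2.symm, row1⟩
end

section
/- For every p ∈ {1,…,d} with sin(θ_p T_s) ≠ 0, the within-pair off-diagonal entries of G^H G satisfy (G^H G)_{2p,2p−1} = (v_p^T h)² · (sin(Mθ_pT_s)/sin(θ_pT_s)) · e^{−i(M−1)θ_pT_s}, and (G^H G)_{2p−1,2p} is the complex conjugate of (G^H G)_{2p,2p−1}. -/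
open Complex Matrix Finset

lemma geom_aux (x : ℂ) (M : ℕ) :
    (∑ k ∈ Finset.range M, (Complex.exp (-x * Complex.I) ^ k * Complex.exp (-x * Complex.I) ^ k))
      * Complex.sin x * Complex.exp (-x * Complex.I)
      = Complex.sin (M * x) * Complex.exp (-x * Complex.I) ^ M := by
  induction M with
  | zero => simp
  | succ n ih =>
    have h1 : Complex.exp (-x * Complex.I) ^ n
        = Complex.cos (n * x) - Complex.sin (n * x) * Complex.I := by
      rw [← Complex.exp_nat_mul, show (n : ℂ) * (-x * Complex.I) = (-(n * x)) * Complex.I by ring,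
        Complex.exp_mul_I, Complex.cos_neg, Complex.sin_neg]
      ring
    have h2 : Complex.exp (-x * Complex.I) * (Complex.cos x + Complex.sin x * Complex.I) = 1 := by
      rw [← Complex.exp_mul_I, ← Complex.exp_add]
      simp
    have h3 : Complex.sin (((n + 1 : ℕ) : ℂ) * x)
        = Complex.sin (n * x) * Complex.cos x + Complex.cos (n * x) * Complex.sin x := by
      rw [← Complex.sin_add]
      push_cast
      ring_nf
    rw [Finset.sum_range_succ, add_mul, add_mul, ih, h3, pow_succ]
    generalize Complex.exp (-x * Complex.I) ^ n = e at *
    linear_combination e * Complex.sin x * Complex.exp (-x * Complex.I) * h1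
      - e * Complex.sin (n * x) * h2

/-- Within-pair off-diagonal entries of `Gᴴ G`:
`(GᴴG)_{2p,2p−1} = (v_pᵀh)²·(sin(Mθ_pT_s)/sin(θ_pT_s))·e^{−i(M−1)θ_pT_s}`,
and `(GᴴG)_{2p−1,2p}` is its complex conjugate. -/
theorem stmt6
    (N d M : ℕ) (hN : 0 < N) (hd : 0 < d) (hMpos : 0 < M) (hdN : 2 * d ≤ N)
    (θ : Fin d → ℝ) (hθpos : ∀ i, 0 < θ i) (hθinj : Function.Injective θ)
    (Ts : ℝ) (hTs : 0 < Ts)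
    (v : Fin d → Fin N → ℂ) (hvnorm : ∀ p, ∑ i, ‖v p i‖ ^ 2 = 1)
    (V : Matrix (Fin N) (Fin (2 * d)) ℂ)
    (hV : ∀ (i : Fin N) (j : Fin (2 * d)),
      V i j = if j.val % 2 = 0
        then v ⟨j.val / 2, by have := j.isLt; omega⟩ i
        else (starRingEnd ℂ) (v ⟨j.val / 2, by have := j.isLt; omega⟩ i))
    (hVrank : V.rank = 2 * d)
    (h : Fin N → ℝ) (hh : h ≠ 0)
    (μ : Fin (2 * d) → ℂ)
    (hμ : ∀ j : Fin (2 * d),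
      μ j = if j.val % 2 = 0
        then Complex.exp (-((θ ⟨j.val / 2, by have := j.isLt; omega⟩ * Ts : ℝ) : ℂ) * Complex.I)
        else Complex.exp (((θ ⟨j.val / 2, by have := j.isLt; omega⟩ * Ts : ℝ) : ℂ) * Complex.I))
    (G : Matrix (Fin M) (Fin (2 * d)) ℂ)
    (hG : ∀ (k : Fin M) (j : Fin (2 * d)), G k j = (∑ i, (h i : ℂ) * V i j) * μ j ^ (k : ℕ))
    (vh : Fin d → ℂ) (hvhdef : ∀ p, vh p = ∑ i, (starRingEnd ℂ) (v p i) * (h i : ℂ))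
    (vt : Fin d → ℂ) (hvtdef : ∀ p, vt p = ∑ i, v p i * (h i : ℂ)) :
    ∀ p : Fin d, Real.sin (θ p * Ts) ≠ 0 →
      (Gᴴ * G) ⟨2 * p.val + 1, by have := p.isLt; omega⟩ ⟨2 * p.val, by have := p.isLt; omega⟩
          = vt p ^ 2 * ((Real.sin ((M : ℝ) * (θ p * Ts)) / Real.sin (θ p * Ts) : ℝ) : ℂ)
            * Complex.exp (-((((M : ℝ) - 1) * (θ p * Ts) : ℝ) : ℂ) * Complex.I) ∧
      (Gᴴ * G) ⟨2 * p.val, by have := p.isLt; omega⟩ ⟨2 * p.val + 1, by have := p.isLt; omega⟩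
          = (starRingEnd ℂ)
              ((Gᴴ * G) ⟨2 * p.val + 1, by have := p.isLt; omega⟩ ⟨2 * p.val, by have := p.isLt; omega⟩) := by
  intro p hp
  have hlt := p.isLt
  have e0 : ∀ k : Fin M, G k ⟨2 * p.val, by omega⟩
      = vt p * Complex.exp (-((θ p * Ts : ℝ) : ℂ) * Complex.I) ^ (k : ℕ) := by
    intro k
    rw [hG, hμ, hvtdef]
    simp [hV, mul_comm]
  have e1 : ∀ k : Fin M, star (G k ⟨2 * p.val + 1, by omega⟩)
      = vt p * Complex.exp (-((θ p * Ts : ℝ) : ℂ) * Complex.I) ^ (k : ℕ) := by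
    intro k
    have a : (2 * p.val + 1) % 2 = 1 := by omega
    have b : (2 * p.val + 1) / 2 = p.val := by omega
    have c1 : star (μ ⟨2 * p.val + 1, by omega⟩)
        = Complex.exp (-((θ p * Ts : ℝ) : ℂ) * Complex.I) := by
      rw [hμ]
      simp only [a, b, one_ne_zero, if_false, Fin.eta]
      change (starRingEnd ℂ) _ = _
      rw [← Complex.exp_conj, map_mul, Complex.conj_I, Complex.conj_ofReal]
      congr 1
      ring
    have c2 : star (∑ i, (h i : ℂ) * V i ⟨2 * p.val + 1, by omega⟩) = vt p := by
      rw [hvtdef]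
      change (starRingEnd ℂ) _ = _
      rw [map_sum]
      refine Finset.sum_congr rfl fun i _ => ?_
      rw [map_mul, Complex.conj_ofReal, hV]
      simp only [a, b, one_ne_zero, if_false, Fin.eta, Complex.conj_conj]
      ring
    rw [hG, star_mul', star_pow, c1, c2]
  constructor
  · have key := geom_aux ((θ p * Ts : ℝ) : ℂ) M
    have hs : Complex.sin ((θ p * Ts : ℝ) : ℂ) ≠ 0 := by
      rw [← Complex.ofReal_sin]
      exact_mod_cast hp
    have hexp : Complex.exp (-((((M : ℝ) - 1) * (θ p * Ts) : ℝ) : ℂ) * Complex.I)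
        * Complex.exp (-((θ p * Ts : ℝ) : ℂ) * Complex.I)
        = Complex.exp (-((θ p * Ts : ℝ) : ℂ) * Complex.I) ^ M := by
      rw [← Complex.exp_add, ← Complex.exp_nat_mul]
      congr 1
      push_cast
      ring
    have hc := Complex.exp_ne_zero (-((θ p * Ts : ℝ) : ℂ) * Complex.I)
    rw [Matrix.mul_apply]
    simp only [Matrix.conjTranspose_apply, e0, e1]
    rw [Fin.sum_univ_eq_sum_range (fun k => vt p * Complex.exp (-((θ p * Ts : ℝ) : ℂ) * Complex.I) ^ k
      * (vt p * Complex.exp (-((θ p * Ts : ℝ) : ℂ) * Complex.I) ^ k)) M]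
    rw [Finset.sum_congr rfl (fun k _ => mul_mul_mul_comm _ _ _ _), ← Finset.mul_sum, ← sq, mul_assoc]
    congr 1
    apply mul_right_cancel₀ hc
    apply mul_right_cancel₀ hs
    rw [mul_assoc _ _ (Complex.exp _), hexp, mul_right_comm, key, Complex.ofReal_div,
      Complex.ofReal_sin, Complex.ofReal_sin, Complex.ofReal_mul (M : ℝ), Complex.ofReal_natCast]
    field_simp
  · simp only [Matrix.mul_apply, Matrix.conjTranspose_apply, map_sum, map_mul]
    refine Finset.sum_congr rfl fun k _ => ?_
    simp [mul_comm]
end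

section
/- For every p, q ∈ {1,…,d} with p ≠ q: if sin((θ_p−θ_q)T_s/2) ≠ 0, then (G^H G)_{2p,2q} = (v_p^T h)(v_q^H h) · (sin(M(θ_p−θ_q)T_s/2)/sin((θ_p−θ_q)T_s/2)) · e^{−i(M−1)(θ_p−θ_q)T_s/2}; and if sin((θ_p+θ_q)T_s/2) ≠ 0, then (G^H G)_{2p,2q−1} = (v_p^T h)(v_q^T h) · (sin(M(θ_p+θ_q)T_s/2)/sin((θ_p+θ_q)T_s/2)) · e^{−i(M−1)(θ_p+θ_q)T_s/2}. -/
open Complex Matrix Finset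

/-- Dirichlet-kernel identity, multiplied out. -/
theorem dirichlet_mul (x : ℂ) (M : ℕ) :
    (∑ k ∈ Finset.range M, Complex.exp (-(2 * x) * Complex.I) ^ k) * Complex.sin x
      = Complex.sin (M * x) * Complex.exp (-((M - 1) * x) * Complex.I) := by
  induction M with
  | zero => simp
  | succ n ih =>
    rw [Finset.sum_range_succ, add_mul, ih, ← Complex.exp_nat_mul]
    have e1 : Complex.exp (-(((n : ℂ) - 1) * x) * Complex.I)
        = Complex.exp (-(n * x) * Complex.I) * Complex.exp (x * Complex.I) := by
      rw [← Complex.exp_add]; congr 1; ring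
    have e2 : Complex.exp ((n : ℂ) * (-(2 * x) * Complex.I))
        = Complex.exp (-(n * x) * Complex.I) * Complex.exp (-(n * x) * Complex.I) := by
      rw [← Complex.exp_add]; congr 1; ring
    have e3 : (((n + 1 : ℕ) : ℂ) - 1) = n := by push_cast; ring
    have e4 : ((n + 1 : ℕ) : ℂ) * x = n * x + x := by push_cast; ring
    have e5 : Complex.exp (-(n * x) * Complex.I)
        = Complex.cos (n * x) - Complex.sin (n * x) * Complex.I := by
      rw [Complex.exp_mul_I, Complex.cos_neg, Complex.sin_neg]; ring
    rw [e1, e2, e3, e4, Complex.sin_add]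
    have e6 := Complex.exp_mul_I x
    generalize Complex.exp (-(n * x) * Complex.I) = E at *
    rw [e6]
    linear_combination (E * Complex.sin x) * e5

theorem dirichlet_sum (x : ℝ) (hx : Real.sin x ≠ 0) (M : ℕ) (a b z w : ℂ)
    (hzw : z * w = Complex.exp (-(2 * (x : ℂ)) * Complex.I)) :
    ∑ k : Fin M, (a * z ^ (k : ℕ)) * (b * w ^ (k : ℕ))
      = a * b * ((Real.sin ((M : ℝ) * x) / Real.sin x : ℝ) : ℂ)
        * Complex.exp (-((((M : ℝ) - 1) * x : ℝ) : ℂ) * Complex.I) := by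
  have hx' : Complex.sin (x : ℂ) ≠ 0 := by
    rw [← Complex.ofReal_sin]; exact_mod_cast hx
  have h1 : ∑ k : Fin M, (a * z ^ (k : ℕ)) * (b * w ^ (k : ℕ))
      = a * b * ∑ k ∈ Finset.range M, Complex.exp (-(2 * (x : ℂ)) * Complex.I) ^ k := by
    rw [← Fin.sum_univ_eq_sum_range (fun k => Complex.exp (-(2 * (x : ℂ)) * Complex.I) ^ k) M,
      Finset.mul_sum]
    refine Finset.sum_congr rfl fun k _ => ?_
    rw [← hzw, mul_pow]; ring
  have h2 := dirichlet_mul (x : ℂ) M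
  rw [h1]
  push_cast
  rw [eq_div_of_mul_eq hx' h2]
  ring

/-- Cross-pair off-diagonal entries of `Gᴴ G` for `p ≠ q`:
`(GᴴG)_{2p,2q}` and `(GᴴG)_{2p,2q−1}` in closed form. -/
theorem stmt7
    (N d M : ℕ) (hN : 0 < N) (hd : 0 < d) (hMpos : 0 < M) (hdN : 2 * d ≤ N)
    (θ : Fin d → ℝ) (hθpos : ∀ i, 0 < θ i) (hθinj : Function.Injective θ)
    (Ts : ℝ) (hTs : 0 < Ts)
    (v : Fin d → Fin N → ℂ) (hvnorm : ∀ p, ∑ i, ‖v p i‖ ^ 2 = 1)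
    (V : Matrix (Fin N) (Fin (2 * d)) ℂ)
    (hV : ∀ (i : Fin N) (j : Fin (2 * d)),
      V i j = if j.val % 2 = 0
        then v ⟨j.val / 2, by have := j.isLt; omega⟩ i
        else (starRingEnd ℂ) (v ⟨j.val / 2, by have := j.isLt; omega⟩ i))
    (hVrank : V.rank = 2 * d)
    (h : Fin N → ℝ) (hh : h ≠ 0)
    (μ : Fin (2 * d) → ℂ)
    (hμ : ∀ j : Fin (2 * d),
      μ j = if j.val % 2 = 0
        then Complex.exp (-((θ ⟨j.val / 2, by have := j.isLt; omega⟩ * Ts : ℝ) : ℂ) * Complex.I)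
        else Complex.exp (((θ ⟨j.val / 2, by have := j.isLt; omega⟩ * Ts : ℝ) : ℂ) * Complex.I))
    (G : Matrix (Fin M) (Fin (2 * d)) ℂ)
    (hG : ∀ (k : Fin M) (j : Fin (2 * d)), G k j = (∑ i, (h i : ℂ) * V i j) * μ j ^ (k : ℕ))
    (vh : Fin d → ℂ) (hvhdef : ∀ p, vh p = ∑ i, (starRingEnd ℂ) (v p i) * (h i : ℂ))
    (vt : Fin d → ℂ) (hvtdef : ∀ p, vt p = ∑ i, v p i * (h i : ℂ)) :
    ∀ p q : Fin d, p ≠ q →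
      (Real.sin ((θ p - θ q) * Ts / 2) ≠ 0 →
        (Gᴴ * G) ⟨2 * p.val + 1, by have := p.isLt; omega⟩ ⟨2 * q.val + 1, by have := q.isLt; omega⟩
          = vt p * vh q
            * ((Real.sin ((M : ℝ) * ((θ p - θ q) * Ts / 2)) / Real.sin ((θ p - θ q) * Ts / 2) : ℝ) : ℂ)
            * Complex.exp (-((((M : ℝ) - 1) * ((θ p - θ q) * Ts / 2) : ℝ) : ℂ) * Complex.I)) ∧
      (Real.sin ((θ p + θ q) * Ts / 2) ≠ 0 →
        (Gᴴ * G) ⟨2 * p.val + 1, by have := p.isLt; omega⟩ ⟨2 * q.val, by have := q.isLt; omega⟩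
          = vt p * vt q
            * ((Real.sin ((M : ℝ) * ((θ p + θ q) * Ts / 2)) / Real.sin ((θ p + θ q) * Ts / 2) : ℝ) : ℂ)
            * Complex.exp (-((((M : ℝ) - 1) * ((θ p + θ q) * Ts / 2) : ℝ) : ℂ) * Complex.I)) := by
  intro p q _
  have Godd : ∀ (r : Fin d) (hr : 2 * r.val + 1 < 2 * d) (k : Fin M), G k ⟨2 * r.val + 1, hr⟩
      = vh r * Complex.exp (((θ r * Ts : ℝ) : ℂ) * Complex.I) ^ (k : ℕ) := by
    intro r hr k
    have hm : ¬ ((2 * r.val + 1) % 2 = 0) := by omega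
    have hq : (2 * r.val + 1) / 2 = r.val := by omega
    rw [hG, hμ, hvhdef]
    simp only [hV, hm, if_false, hq, Fin.eta]
    simp only [mul_comm]
  have Geven : ∀ (r : Fin d) (hr : 2 * r.val < 2 * d) (k : Fin M), G k ⟨2 * r.val, hr⟩
      = vt r * Complex.exp (-((θ r * Ts : ℝ) : ℂ) * Complex.I) ^ (k : ℕ) := by
    intro r hr k
    have hm : (2 * r.val) % 2 = 0 := by omega
    have hq : (2 * r.val) / 2 = r.val := by omega
    rw [hG, hμ, hvtdef]
    simp only [hV, hm, if_true, hq, Fin.eta]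
    simp only [mul_comm]
  have hstar : star (vh p) = vt p := by
    rw [hvhdef, hvtdef]; simp
  have hexp : star (Complex.exp (((θ p * Ts : ℝ) : ℂ) * Complex.I))
      = Complex.exp (-((θ p * Ts : ℝ) : ℂ) * Complex.I) := by
    change (starRingEnd ℂ) _ = _
    rw [← Complex.exp_conj, map_mul, Complex.conj_ofReal, Complex.conj_I]
    congr 1; ring
  constructor
  · intro hs
    rw [Matrix.mul_apply]
    simp only [Matrix.conjTranspose_apply, Godd, star_mul', star_pow, hstar, hexp]
    apply dirichlet_sum _ hs
    rw [← Complex.exp_add]; congr 1; push_cast; ring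
  · intro hs
    rw [Matrix.mul_apply]
    simp only [Matrix.conjTranspose_apply, Godd, Geven, star_mul', star_pow, hstar, hexp]
    apply dirichlet_sum _ hs
    rw [← Complex.exp_add]; congr 1; push_cast; ring
end

section
/- Suppose the A_Φ-eigenvalues e^{±iθ_iT_s} are pairwise distinct and each has nonzero imaginary part, and ‖h‖₂² = 2d/M. Then for every α ∈ ℂ^{2d}, (2dκ₁² − (2d/M)(2d−1)νκ₂²)·‖α‖₂² ≤ ‖Gα‖₂² ≤ (2dκ₂² + (2d/M)(2d−1)νκ₂²)·‖α‖₂²; equivalently, every eigenvalue of the Hermitian matrix G^H G lies in the real interval [2dκ₁² − (2d/M)(2d−1)νκ₂², 2dκ₂² + (2d/M)(2d−1)νκ₂²]. -/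
open Complex Matrix Finset

lemma aux_geom_s9 (φ : ℝ) (M : ℕ) (hne : Complex.exp (Complex.I * φ) ≠ 1) :
    ‖∑ k : Fin M, (Complex.exp (Complex.I * φ)) ^ (k : ℕ)‖ ≤ 1 / |Real.sin (φ / 2)| := by
  have h1 := Complex.norm_exp_I_mul_ofReal_sub_one φ
  have hz : ‖Complex.exp (Complex.I * φ)‖ = 1 := by
    rw [mul_comm]; exact Complex.norm_exp_ofReal_mul_I φ
  rw [Fin.sum_univ_eq_sum_range (fun k => (Complex.exp (Complex.I * φ)) ^ k) M, geom_sum_eq hne,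
    norm_div, h1]
  have hs : 0 < |Real.sin (φ / 2)| := by
    rw [abs_pos]
    intro h0
    rw [h0] at h1
    simp [sub_eq_zero] at h1
    exact hne h1
  have h2 : ‖Complex.exp (Complex.I * φ) ^ M - 1‖ ≤ 2 := by
    calc _ ≤ ‖Complex.exp (Complex.I * φ) ^ M‖ + ‖(1 : ℂ)‖ := norm_sub_le _ _
      _ = 2 := by rw [norm_pow, hz]; norm_num
  rw [norm_mul, Real.norm_eq_abs, Real.norm_eq_abs, div_le_div_iff₀ (by positivity) hs]
  norm_num
  nlinarith

lemma aux_sum (n M : ℕ) (x μ : Fin n → ℂ) (ν : ℝ) (hμ : ∀ j, ‖μ j‖ = 1)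
    (hν : ∀ j l, j ≠ l → ‖∑ k : Fin M, ((starRingEnd ℂ) (μ j) * μ l) ^ (k : ℕ)‖ ≤ ν) :
    |∑ k : Fin M, ‖∑ j, x j * μ j ^ (k : ℕ)‖ ^ 2 - M * ∑ j, ‖x j‖ ^ 2|
      ≤ ν * ((n : ℝ) - 1) * ∑ j, ‖x j‖ ^ 2 := by
  have key : ((∑ k : Fin M, ‖∑ j, x j * μ j ^ (k : ℕ)‖ ^ 2 - M * ∑ j, ‖x j‖ ^ 2 : ℝ) : ℂ)
      = ∑ j, ∑ l, (starRingEnd ℂ) (x j) * x l *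
        ((∑ k : Fin M, ((starRingEnd ℂ) (μ j) * μ l) ^ (k : ℕ)) - if j = l then (M : ℂ) else 0) := by
    simp only [mul_sub, Finset.sum_sub_distrib]
    push_cast
    congr 1
    · simp only [← Complex.conj_mul', map_sum, Finset.sum_mul_sum, map_mul, map_pow]
      rw [Finset.sum_comm]
      refine Finset.sum_congr rfl fun j _ => ?_
      rw [Finset.sum_comm]
      refine Finset.sum_congr rfl fun l _ => ?_
      rw [Finset.mul_sum]
      refine Finset.sum_congr rfl fun k _ => ?_
      rw [mul_pow]; ring
    · simp only [mul_ite, mul_zero, Finset.sum_ite_eq, Finset.mem_univ, if_true,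
        Complex.conj_mul', Finset.mul_sum]
      refine Finset.sum_congr rfl fun j _ => ?_
      ring
  rw [← Real.norm_eq_abs, ← Complex.norm_real, key]
  calc _ ≤ ∑ j, ∑ l, (‖x j‖ ^ 2 + ‖x l‖ ^ 2) / 2 * (ν - if j = l then ν else 0) := by
        refine (norm_sum_le _ _).trans (Finset.sum_le_sum fun j _ => ?_)
        refine (norm_sum_le _ _).trans (Finset.sum_le_sum fun l _ => ?_)
        by_cases hjl : j = l
        · subst hjl
          simp [Complex.conj_mul', hμ]
        · rw [norm_mul, norm_mul, RCLike.norm_conj]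
          simp only [hjl, if_false, sub_zero]
          refine mul_le_mul ?_ (hν j l hjl) (norm_nonneg _) (by positivity)
          nlinarith [sq_nonneg (‖x j‖ - ‖x l‖)]
    _ = _ := by
        simp only [mul_sub, Finset.sum_sub_distrib, mul_ite, mul_zero, Finset.sum_ite_eq,
          Finset.mem_univ, if_true, add_div, add_mul, Finset.sum_add_distrib, Finset.sum_const,
          Finset.card_univ, Fintype.card_fin, nsmul_eq_mul, ← Finset.sum_mul, ← Finset.sum_div,
          ← Finset.mul_sum]
        ring

/-- Frame bounds for `G`: if `‖h‖₂² = 2d/M`, then for every `α ∈ ℂ^{2d}`,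
`(2dκ₁² − (2d/M)(2d−1)νκ₂²)·‖α‖₂² ≤ ‖Gα‖₂² ≤ (2dκ₂² + (2d/M)(2d−1)νκ₂²)·‖α‖₂²`;
equivalently every eigenvalue of `Gᴴ G` lies in the corresponding interval. -/
theorem stmt9
    (N d M : ℕ) (hN : 0 < N) (hd : 0 < d) (hMpos : 0 < M) (hdN : 2 * d ≤ N)
    (θ : Fin d → ℝ) (hθpos : ∀ i, 0 < θ i) (hθinj : Function.Injective θ)
    (Ts : ℝ) (hTs : 0 < Ts)
    (v : Fin d → Fin N → ℂ) (hvnorm : ∀ p, ∑ i, ‖v p i‖ ^ 2 = 1)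
    (V : Matrix (Fin N) (Fin (2 * d)) ℂ)
    (hV : ∀ (i : Fin N) (j : Fin (2 * d)),
      V i j = if j.val % 2 = 0
        then v ⟨j.val / 2, by have := j.isLt; omega⟩ i
        else (starRingEnd ℂ) (v ⟨j.val / 2, by have := j.isLt; omega⟩ i))
    (hVrank : V.rank = 2 * d)
    (h : Fin N → ℝ) (hh : h ≠ 0)
    (μ : Fin (2 * d) → ℂ)
    (hμ : ∀ j : Fin (2 * d),
      μ j = if j.val % 2 = 0
        then Complex.exp (-((θ ⟨j.val / 2, by have := j.isLt; omega⟩ * Ts : ℝ) : ℂ) * Complex.I)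
        else Complex.exp (((θ ⟨j.val / 2, by have := j.isLt; omega⟩ * Ts : ℝ) : ℂ) * Complex.I))
    (G : Matrix (Fin M) (Fin (2 * d)) ℂ)
    (hG : ∀ (k : Fin M) (j : Fin (2 * d)), G k j = (∑ i, (h i : ℂ) * V i j) * μ j ^ (k : ℕ))
    (vh : Fin d → ℂ) (hvhdef : ∀ p, vh p = ∑ i, (starRingEnd ℂ) (v p i) * (h i : ℂ))
    (hne : (Finset.univ : Finset (Fin d)).Nonempty)
    (κ₁ κ₂ : ℝ)
    (hκ₁def : κ₁ = Finset.univ.inf' hne fun p => ‖vh p‖ / Real.sqrt (∑ i, h i ^ 2))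
    (hκ₂def : κ₂ = Finset.univ.sup' hne fun p => ‖vh p‖ / Real.sqrt (∑ i, h i ^ 2))
    (ν : ℝ)
    (hνdef : ν = sSup ({r : ℝ | ∃ p : Fin d, r = 1 / |Real.sin (θ p * Ts)|} ∪
      {r : ℝ | ∃ p q : Fin d, p ≠ q ∧
        (r = 1 / |Real.sin ((θ p - θ q) * Ts / 2)| ∨
         r = 1 / |Real.sin ((θ p + θ q) * Ts / 2)|)}))
    (hμinj : Function.Injective μ) (hμim : ∀ j, (μ j).im ≠ 0)
    (hhnorm : ∑ i, h i ^ 2 = 2 * (d : ℝ) / (M : ℝ))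
    (hHermG : (Gᴴ * G).IsHermitian) :
    (∀ α : Fin (2 * d) → ℂ,
      (2 * (d : ℝ) * κ₁ ^ 2 - (2 * (d : ℝ) / (M : ℝ)) * (2 * (d : ℝ) - 1) * ν * κ₂ ^ 2)
          * (∑ j, ‖α j‖ ^ 2) ≤ ∑ k, ‖G.mulVec α k‖ ^ 2 ∧
      ∑ k, ‖G.mulVec α k‖ ^ 2 ≤
        (2 * (d : ℝ) * κ₂ ^ 2 + (2 * (d : ℝ) / (M : ℝ)) * (2 * (d : ℝ) - 1) * ν * κ₂ ^ 2)
          * (∑ j, ‖α j‖ ^ 2)) ∧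
    (∀ i : Fin (2 * d),
      2 * (d : ℝ) * κ₁ ^ 2 - (2 * (d : ℝ) / (M : ℝ)) * (2 * (d : ℝ) - 1) * ν * κ₂ ^ 2
          ≤ hHermG.eigenvalues i ∧
      hHermG.eigenvalues i ≤
        2 * (d : ℝ) * κ₂ ^ 2 + (2 * (d : ℝ) / (M : ℝ)) * (2 * (d : ℝ) - 1) * ν * κ₂ ^ 2) := by
  have hMR : (0 : ℝ) < M := by exact_mod_cast hMpos
  have hdR : (1 : ℝ) ≤ d := by exact_mod_cast hd
  set H : ℝ := 2 * (d : ℝ) / (M : ℝ) with hH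
  have hHpos : 0 < H := by positivity
  rw [hhnorm] at hκ₁def hκ₂def
  have hsq : Real.sqrt H ^ 2 = H := Real.sq_sqrt hHpos.le
  have hsp : 0 < Real.sqrt H := Real.sqrt_pos.mpr hHpos
  let P : Fin (2 * d) → Fin d := fun j => ⟨j.val / 2, by have := j.isLt; omega⟩
  let φ : Fin (2 * d) → ℝ := fun j => if j.val % 2 = 0 then -(θ (P j) * Ts) else θ (P j) * Ts
  have hμφ : ∀ j, μ j = Complex.exp (Complex.I * (φ j : ℝ)) := by
    intro j
    rw [hμ j]
    simp only [φ, P]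
    split_ifs <;> (congr 1; push_cast; ring)
  have hμn : ∀ j, ‖μ j‖ = 1 := by
    intro j
    rw [hμφ, mul_comm]; exact Complex.norm_exp_ofReal_mul_I _
  have hprod : ∀ j l, (starRingEnd ℂ) (μ j) * μ l
      = Complex.exp (Complex.I * ((φ l - φ j : ℝ) : ℂ)) := by
    intro j l
    rw [hμφ, hμφ, ← Complex.exp_conj, ← Complex.exp_add]
    congr 1
    simp only [map_mul, Complex.conj_I, Complex.conj_ofReal]
    push_cast; ring
  have hbdd : BddAbove ({r : ℝ | ∃ p : Fin d, r = 1 / |Real.sin (θ p * Ts)|} ∪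
      {r : ℝ | ∃ p q : Fin d, p ≠ q ∧
        (r = 1 / |Real.sin ((θ p - θ q) * Ts / 2)| ∨
         r = 1 / |Real.sin ((θ p + θ q) * Ts / 2)|)}) := by
    apply Set.Finite.bddAbove
    apply Set.Finite.union
    · refine (Set.finite_range (fun p : Fin d => 1 / |Real.sin (θ p * Ts)|)).subset ?_
      rintro r ⟨p, rfl⟩
      exact ⟨p, rfl⟩
    · refine ((Set.finite_range (fun p : Fin d × Fin d =>
        1 / |Real.sin ((θ p.1 - θ p.2) * Ts / 2)|)).union (Set.finite_range
        (fun p : Fin d × Fin d => 1 / |Real.sin ((θ p.1 + θ p.2) * Ts / 2)|))).subset ?_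
      rintro r ⟨p, q, _, rfl | rfl⟩
      · exact Or.inl ⟨(p, q), rfl⟩
      · exact Or.inr ⟨(p, q), rfl⟩
  have hν1 : ∀ p, 1 / |Real.sin (θ p * Ts)| ≤ ν := fun p => by
    rw [hνdef]; exact le_csSup hbdd (Or.inl ⟨p, rfl⟩)
  have hν2 : ∀ p q, p ≠ q → 1 / |Real.sin ((θ p - θ q) * Ts / 2)| ≤ ν := fun p q hpq => by
    rw [hνdef]; exact le_csSup hbdd (Or.inr ⟨p, q, hpq, Or.inl rfl⟩)
  have hν3 : ∀ p q, p ≠ q → 1 / |Real.sin ((θ p + θ q) * Ts / 2)| ≤ ν := fun p q hpq => by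
    rw [hνdef]; exact le_csSup hbdd (Or.inr ⟨p, q, hpq, Or.inr rfl⟩)
  have hν0 : 0 ≤ ν := le_trans (by positivity) (hν1 ⟨0, hd⟩)
  have hνφ : ∀ j l, j ≠ l → 1 / |Real.sin ((φ l - φ j) / 2)| ≤ ν := by
    intro j l hjl
    have hneg : ∀ x y : ℝ, x = -y → |Real.sin x| = |Real.sin y| := by
      rintro x y rfl
      rw [Real.sin_neg, abs_neg]
    by_cases hP : P j = P l
    · have hdiv : j.val / 2 = l.val / 2 := by
        have := congrArg Fin.val hP
        simpa [P] using this
      have hval : j.val ≠ l.val := fun h => hjl (Fin.ext h)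
      have h1 := hν1 (P l)
      simp only [φ, hP]
      split_ifs with ha hb hb
      · omega
      · rw [hneg _ (θ (P l) * Ts) (by ring)]; exact h1
      · rw [show (θ (P l) * Ts - -(θ (P l) * Ts)) / 2 = θ (P l) * Ts by ring]; exact h1
      · omega
    · have h2 := hν2 (P l) (P j) (Ne.symm hP)
      have h3 := hν3 (P l) (P j) (Ne.symm hP)
      simp only [φ]
      split_ifs with ha hb hb
      · rw [hneg _ ((θ (P l) - θ (P j)) * Ts / 2) (by ring)]; exact h2
      · rw [hneg _ ((θ (P l) + θ (P j)) * Ts / 2) (by ring)]; exact h3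
      · rw [show (θ (P l) * Ts - -(θ (P j) * Ts)) / 2 = (θ (P l) + θ (P j)) * Ts / 2 by ring]
        exact h3
      · rw [show (θ (P l) * Ts - θ (P j) * Ts) / 2 = (θ (P l) - θ (P j)) * Ts / 2 by ring]
        exact h2
  have hS : ∀ j l, j ≠ l →
      ‖∑ k : Fin M, ((starRingEnd ℂ) (μ j) * μ l) ^ (k : ℕ)‖ ≤ ν := by
    intro j l hjl
    rw [hprod]
    refine (aux_geom_s9 _ M ?_).trans (hνφ j l hjl)
    intro h1
    rw [← hprod] at h1
    apply hjl
    apply hμinj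
    have h2 : μ j * (starRingEnd ℂ) (μ j) = 1 := by
      rw [Complex.mul_conj', hμn]; simp
    calc μ j = μ j * ((starRingEnd ℂ) (μ j) * μ l) := by rw [h1, mul_one]
      _ = (μ j * (starRingEnd ℂ) (μ j)) * μ l := by ring
      _ = μ l := by rw [h2, one_mul]
  let c : Fin (2 * d) → ℂ := fun j => ∑ i, (h i : ℂ) * V i j
  have hc : ∀ j, ‖c j‖ = ‖vh (P j)‖ := by
    intro j
    rw [hvhdef]
    simp only [c, hV]
    split_ifs
    · rw [← RCLike.norm_conj, map_sum]
      congr 1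
      refine Finset.sum_congr rfl fun i _ => ?_
      simp [P, mul_comm]
    · congr 1
      refine Finset.sum_congr rfl fun i _ => ?_
      simp [P, mul_comm]
  have hk1 : 0 ≤ κ₁ := by
    rw [hκ₁def]
    exact Finset.le_inf' _ _ fun p _ => by positivity
  have hc1 : ∀ j, H * κ₁ ^ 2 ≤ ‖c j‖ ^ 2 := by
    intro j
    have : κ₁ ≤ ‖vh (P j)‖ / Real.sqrt H := by
      rw [hκ₁def]; exact Finset.inf'_le _ (Finset.mem_univ _)
    rw [le_div_iff₀ hsp] at this
    have h2 := pow_le_pow_left₀ (by positivity) this 2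
    rw [mul_pow, hsq] at h2
    rw [hc]; linarith
  have hc2 : ∀ j, ‖c j‖ ^ 2 ≤ H * κ₂ ^ 2 := by
    intro j
    have : ‖vh (P j)‖ / Real.sqrt H ≤ κ₂ := by
      rw [hκ₂def]
      exact Finset.le_sup' (fun p => ‖vh p‖ / Real.sqrt H) (Finset.mem_univ (P j))
    rw [div_le_iff₀ hsp] at this
    have h2 := pow_le_pow_left₀ (by positivity) this 2
    rw [mul_pow, hsq] at h2
    rw [hc]; linarith
  have hMH : (M : ℝ) * H = 2 * d := by rw [hH]; field_simp
  have main : ∀ α : Fin (2 * d) → ℂ,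
      (2 * (d : ℝ) * κ₁ ^ 2 - H * (2 * (d : ℝ) - 1) * ν * κ₂ ^ 2)
          * (∑ j, ‖α j‖ ^ 2) ≤ ∑ k, ‖G.mulVec α k‖ ^ 2 ∧
      ∑ k, ‖G.mulVec α k‖ ^ 2 ≤
        (2 * (d : ℝ) * κ₂ ^ 2 + H * (2 * (d : ℝ) - 1) * ν * κ₂ ^ 2)
          * (∑ j, ‖α j‖ ^ 2) := by
    intro α
    have h1 := aux_sum (2 * d) M (fun j => c j * α j) μ ν hμn hS
    have hGα : ∀ k, G.mulVec α k = ∑ j, c j * α j * μ j ^ (k : ℕ) := by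
      intro k
      simp only [Matrix.mulVec, dotProduct, hG]
      refine Finset.sum_congr rfl fun j _ => ?_
      simp only [c]; ring
    simp only [hGα]
    have hlo : H * κ₁ ^ 2 * ∑ j, ‖α j‖ ^ 2 ≤ ∑ j, ‖c j * α j‖ ^ 2 := by
      rw [Finset.mul_sum]
      refine Finset.sum_le_sum fun j _ => ?_
      rw [norm_mul, mul_pow]
      exact mul_le_mul_of_nonneg_right (hc1 j) (by positivity)
    have hhi : ∑ j, ‖c j * α j‖ ^ 2 ≤ H * κ₂ ^ 2 * ∑ j, ‖α j‖ ^ 2 := by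
      rw [Finset.mul_sum]
      refine Finset.sum_le_sum fun j _ => ?_
      rw [norm_mul, mul_pow]
      exact mul_le_mul_of_nonneg_right (hc2 j) (by positivity)
    rw [abs_le] at h1
    push_cast at h1
    have e1 := mul_le_mul_of_nonneg_left hhi
      (show 0 ≤ ν * (2 * (d : ℝ) - 1) from mul_nonneg hν0 (by linarith))
    have e2 := mul_le_mul_of_nonneg_left hhi hMR.le
    have e3 := mul_le_mul_of_nonneg_left hlo hMR.le
    rw [← hMH] at e1 h1 ⊢
    constructor
    · linarith [h1.1]
    · linarith [h1.2]
  refine ⟨main, fun i => ?_⟩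
  have hei := main (hHermG.eigenvectorBasis i)
  have hnorm : ∑ j, ‖hHermG.eigenvectorBasis i j‖ ^ 2 = 1 := by
    rw [← EuclideanSpace.norm_sq_eq, hHermG.eigenvectorBasis.orthonormal.1 i]; norm_num
  have hval : hHermG.eigenvalues i
      = ∑ k, ‖G.mulVec (hHermG.eigenvectorBasis i) k‖ ^ 2 := by
    rw [hHermG.eigenvalues_eq i, ← Matrix.mulVec_mulVec, Matrix.dotProduct_mulVec,
      ← Matrix.star_mulVec]
    simp only [dotProduct, Pi.star_apply, RCLike.star_def, Complex.conj_mul']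
    rw [map_sum]
    refine Finset.sum_congr rfl fun k _ => ?_
    norm_cast
  rw [hnorm, mul_one, mul_one, ← hval] at hei
  exact hei
end

section
/- Suppose M = 2d. Then G factors as G = W·H̃, where W ∈ ℂ^{2d×2d} is the Vandermonde-type matrix with entries W_{k,j} = μ_j^{k−1} for μ_{2p−1} = e^{−iθ_pT_s} and μ_{2p} = e^{iθ_pT_s}, and H̃ = diag(v_1^T h, v_1^H h, …, v_d^T h, v_d^H h); consequently det G = (Π_{1≤j<k≤2d} (μ_k − μ_j)) · Π_{p=1}^{d} (v_p^T h)(v_p^H h). In particular, if the 2d numbers μ_1,…,μ_{2d} are pairwise distinct and v_p^H h ≠ 0 for all p, then det G ≠ 0. -/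
open Complex Matrix Finset

theorem prod_fin_two_mul_aux (d : ℕ) (f : Fin (2 * d) → ℂ) :
    ∏ j, f j = ∏ p : Fin d, (f ⟨2 * p.val, by have := p.isLt; omega⟩ *
      f ⟨2 * p.val + 1, by have := p.isLt; omega⟩) := by
  induction d with
  | zero => simp
  | succ n ih =>
    rw [Fin.prod_univ_castSucc (n := n)]
    have e : ∏ j, f j = ∏ j : Fin (2 * n + 1 + 1), f j := rfl
    rw [e, Fin.prod_univ_castSucc, Fin.prod_univ_castSucc, mul_assoc]
    congr 1
    exact ih (fun j => f j.castSucc.castSucc)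

/-- For `M = 2d`, `G` factors as a Vandermonde-type matrix times the diagonal
matrix of projections `v_pᵀh, v_pᴴh`; hence
`det G = (Π_{j<k}(μ_k − μ_j))·Π_p (v_pᵀh)(v_pᴴh)`, which is nonzero whenever the
`μ_j` are pairwise distinct and `v_p^H h ≠ 0` for all `p`. -/
theorem stmt10
    (N d : ℕ) (hN : 0 < N) (hd : 0 < d) (hdN : 2 * d ≤ N)
    (θ : Fin d → ℝ) (hθpos : ∀ i, 0 < θ i) (hθinj : Function.Injective θ)
    (Ts : ℝ) (hTs : 0 < Ts)
    (v : Fin d → Fin N → ℂ) (hvnorm : ∀ p, ∑ i, ‖v p i‖ ^ 2 = 1)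
    (V : Matrix (Fin N) (Fin (2 * d)) ℂ)
    (hV : ∀ (i : Fin N) (j : Fin (2 * d)),
      V i j = if j.val % 2 = 0
        then v ⟨j.val / 2, by have := j.isLt; omega⟩ i
        else (starRingEnd ℂ) (v ⟨j.val / 2, by have := j.isLt; omega⟩ i))
    (hVrank : V.rank = 2 * d)
    (h : Fin N → ℝ) (hh : h ≠ 0)
    (μ : Fin (2 * d) → ℂ)
    (hμ : ∀ j : Fin (2 * d),
      μ j = if j.val % 2 = 0
        then Complex.exp (-((θ ⟨j.val / 2, by have := j.isLt; omega⟩ * Ts : ℝ) : ℂ) * Complex.I)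
        else Complex.exp (((θ ⟨j.val / 2, by have := j.isLt; omega⟩ * Ts : ℝ) : ℂ) * Complex.I))
    (G : Matrix (Fin (2 * d)) (Fin (2 * d)) ℂ)
    (hG : ∀ (k j : Fin (2 * d)), G k j = (∑ i, (h i : ℂ) * V i j) * μ j ^ (k : ℕ))
    (vh : Fin d → ℂ) (hvhdef : ∀ p, vh p = ∑ i, (starRingEnd ℂ) (v p i) * (h i : ℂ))
    (vt : Fin d → ℂ) (hvtdef : ∀ p, vt p = ∑ i, v p i * (h i : ℂ)) :
    G = (Matrix.of fun k j : Fin (2 * d) => μ j ^ (k : ℕ)) *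
          Matrix.diagonal (fun j => ∑ i, (h i : ℂ) * V i j) ∧
    G.det = (∏ j : Fin (2 * d), ∏ k ∈ Finset.Ioi j, (μ k - μ j)) * ∏ p : Fin d, (vt p * vh p) ∧
    ((Function.Injective μ ∧ ∀ p, vh p ≠ 0) → G.det ≠ 0) := by
  have h1 : G = (Matrix.of fun k j : Fin (2 * d) => μ j ^ (k : ℕ)) *
          Matrix.diagonal (fun j => ∑ i, (h i : ℂ) * V i j) := by
    ext k j
    rw [Matrix.mul_diagonal, hG, Matrix.of_apply, mul_comm]
  have hW : (Matrix.of fun k j : Fin (2 * d) => μ j ^ (k : ℕ)) = (Matrix.vandermonde μ)ᵀ := by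
    ext k j
    simp [Matrix.vandermonde_apply]
  have h2 : G.det = (∏ j : Fin (2 * d), ∏ k ∈ Finset.Ioi j, (μ k - μ j)) *
      ∏ p : Fin d, (vt p * vh p) := by
    rw [h1, Matrix.det_mul, Matrix.det_diagonal, hW, Matrix.det_transpose,
      Matrix.det_vandermonde, prod_fin_two_mul_aux d (fun j => ∑ i, (h i : ℂ) * V i j)]
    congr 1
    refine Finset.prod_congr rfl fun p _ => ?_
    have a1 : 2 * p.val / 2 = p.val := by omega
    have a2 : (2 * p.val + 1) / 2 = p.val := by omega
    have a3 : (2 * p.val + 1) % 2 = 1 := by omega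
    rw [hvtdef, hvhdef]
    congr 1
    · refine Finset.sum_congr rfl fun i _ => ?_
      rw [hV, mul_comm]
      simp [a1]
    · refine Finset.sum_congr rfl fun i _ => ?_
      rw [hV, mul_comm]
      simp [a2, a3]
  refine ⟨h1, h2, ?_⟩
  rintro ⟨hinj, hne⟩
  rw [h2, ← Matrix.det_vandermonde]
  refine mul_ne_zero (Matrix.det_vandermonde_ne_zero_iff.2 hinj)
    (Finset.prod_ne_zero_iff.2 fun p _ => mul_ne_zero ?_ (hne p))
  have hc : vh p = (starRingEnd ℂ) (vt p) := by
    rw [hvhdef, hvtdef, map_sum]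
    simp
  intro h0
  apply hne p
  rw [hc, h0, map_zero]
end
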